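/- Let (Ω, C, Λ) be a naive convex co-compact triple. Then the following are equivalent: (1) there exists R > 0 such that diam_{F_Ω(x)}(∂_i C ∩ F_Ω(x)) ≤ R for all x ∈ ∂_i C, where the diameter is with respect to the Hilbert metric of the face F_Ω(x); (2) cdim_{F_Ω(x)}(∂_i C ∩ F_Ω(x)) = 0 for all x ∈ ∂_i C; (3) C does not contain a properly embedded simplex of dimension at least two; (4) the metric space (C, d_Ω) is Gromov hyperbolic. -/

import Mathlib

open Set Filter

noncomputable section

/-- Real projective space `P(ℝ^d)`, with the quotient topology. -/
abbrev PSpace (d : ℕ) := Projectivization ℝ (Fin d → ℝ)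

instance PSpace.instTopologicalSpace (d : ℕ) : TopologicalSpace (PSpace d) :=
  inferInstanceAs (TopologicalSpace (Quotient (projectivizationSetoid ℝ (Fin d → ℝ))))

namespace Paper

variable {d : ℕ}

/-- Inhomogeneous coordinates in the affine chart determined by the linear functional `f`:
a projective point `[v]` with `f v ≠ 0` is sent to the representative `v / f v` lying in the
affine hyperplane `{f = 1}`. -/
def chartMap (f : (Fin d → ℝ) →ₗ[ℝ] ℝ) (x : PSpace d) : Fin d → ℝ :=
  (f x.rep)⁻¹ • x.rep

/-- A subset of `P(ℝ^d)` is properly convex if there is an affine chart in which it is a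
bounded convex set. -/
def IsProperlyConvex (C : Set (PSpace d)) : Prop :=
  ∃ f : (Fin d → ℝ) →ₗ[ℝ] ℝ, (∀ x ∈ closure C, f x.rep ≠ 0) ∧
    Convex ℝ (chartMap f '' C) ∧ Bornology.IsBounded (chartMap f '' C)

/-- A properly convex domain: an open, nonempty, properly convex subset of `P(ℝ^d)`. -/
def IsPCDomain (Ω : Set (PSpace d)) : Prop :=
  IsOpen Ω ∧ Ω.Nonempty ∧ IsProperlyConvex Ω

open Classical in
/-- A choice of an affine chart containing the properly convex set `C`. -/
def chartOf (C : Set (PSpace d)) : (Fin d → ℝ) →ₗ[ℝ] ℝ :=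
  if h : IsProperlyConvex C then h.choose else 0

/-- The chart map associated to the chosen chart of `C`. -/
def cmap (C : Set (PSpace d)) : PSpace d → Fin d → ℝ := chartMap (chartOf C)

/-- The Hilbert distance between `u` and `v` computed in an affine chart where the convex set
is `O`: writing the line through `u, v` as `t ↦ u + t(v-u)`, with boundary parameters
`tm = inf {t | u + t(v-u) ∈ O} ≤ 0` and `tp = sup {...} ≥ 1`, the cross-ratio
`[a,u,v,b]` of `a = u + tm(v-u), u, v, b = u + tp(v-u)` equals `(tp(1-tm))/((-tm)(tp-1))`. -/
def hilbertDistChart (O : Set (Fin d → ℝ)) (u v : Fin d → ℝ) : ℝ :=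
  if u = v then 0
  else
    (1 / 2) * Real.log
      ((sSup {t : ℝ | u + t • (v - u) ∈ O} * (1 - sInf {t : ℝ | u + t • (v - u) ∈ O})) /
        ((-(sInf {t : ℝ | u + t • (v - u) ∈ O})) * (sSup {t : ℝ | u + t • (v - u) ∈ O} - 1)))

/-- The Hilbert metric of a properly convex set `C` (open in its span). -/
def hilbertDist (C : Set (PSpace d)) (x y : PSpace d) : ℝ :=
  hilbertDistChart (cmap C '' C) (cmap C x) (cmap C y)

/-- The closed projective line segment `[x,y]` contained in `closure C`. -/
def projSeg (C : Set (PSpace d)) (x y : PSpace d) : Set (PSpace d) :=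
  {z ∈ closure C | cmap C z ∈ segment ℝ (cmap C x) (cmap C y)}

/-- The open projective line segment `(x,y)` contained in `closure C`. -/
def projOpenSeg (C : Set (PSpace d)) (x y : PSpace d) : Set (PSpace d) :=
  {z ∈ closure C | cmap C z ∈ openSegment ℝ (cmap C x) (cmap C y)}

/-- The open face `F_C(x)` of a point `x ∈ closure C`: the set `{x}` together with all
`y ∈ closure C` such that some open line segment contained in `closure C` contains
both `x` and `y`. -/
def face (C : Set (PSpace d)) (x : PSpace d) : Set (PSpace d) :=
  insert x {y ∈ closure C | ∃ a ∈ closure C, ∃ b ∈ closure C,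
    x ∈ projOpenSeg C a b ∧ y ∈ projOpenSeg C a b}

/-- The ideal boundary `∂_i C = closure C \ C`. -/
def idealBdry (C : Set (PSpace d)) : Set (PSpace d) := closure C \ C

/-- The dimension of a subset `B`, computed in the chart of the ambient convex set `C`. -/
def pdimIn (C B : Set (PSpace d)) : ℕ :=
  Module.finrank ℝ (affineSpan ℝ (cmap C '' B)).direction

/-- The dimension of a convex subset of `P(ℝ^d)`. -/
def pdim (A : Set (PSpace d)) : ℕ := pdimIn A A

/-- The coarse dimension `cdim_C(A)` of a nonempty subset `A` of a properly convex set `C`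
open in its span: the smallest `k` such that `A` is contained in an `R`-neighborhood (for the
Hilbert metric of `C`) of a `k`-dimensional convex subset `B ⊆ C`. -/
def cdim (C A : Set (PSpace d)) : ℕ :=
  sInf {k : ℕ | ∃ R : ℝ, 0 < R ∧ ∃ B : Set (PSpace d), B ⊆ C ∧
    Convex ℝ (cmap C '' B) ∧ pdimIn C B = k ∧
    A ⊆ {p ∈ C | ∃ q ∈ B, hilbertDist C p q < R}}

/-- The cone over the standard open `(p-1)`-dimensional simplex: vectors whose first `p`
coordinates are positive and whose remaining coordinates vanish. -/
def simplexCone (p : ℕ) : Set (Fin d → ℝ) :=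
  {v | (∀ i : Fin d, (i : ℕ) < p → 0 < v i) ∧ ∀ i : Fin d, p ≤ (i : ℕ) → v i = 0}

/-- `S` is the image under `g ∈ PGL_d(ℝ)` of the standard open simplex with `p` vertices. -/
def IsSimplexWithMap (p : ℕ) (S : Set (PSpace d)) (g : (Fin d → ℝ) ≃ₗ[ℝ] (Fin d → ℝ)) : Prop :=
  S = {q : PSpace d | ∃ v ∈ simplexCone (d := d) p, ∃ hv : v ≠ 0,
        q = Projectivization.mk ℝ (g v) (by simpa using hv)}

/-- `S ⊆ P(ℝ^d)` is a simplex of dimension `k`. -/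
def IsSimplexOfDim (k : ℕ) (S : Set (PSpace d)) : Prop :=
  k + 1 ≤ d ∧ ∃ g : (Fin d → ℝ) ≃ₗ[ℝ] (Fin d → ℝ), IsSimplexWithMap (k + 1) S g

/-- `S` is a simplex with vertices `v 0, …, v (p-1)` (so of dimension `p - 1`). -/
def HasVertices {p : ℕ} (S : Set (PSpace d)) (v : Fin p → PSpace d) : Prop :=
  ∃ (hp : p ≤ d) (g : (Fin d → ℝ) ≃ₗ[ℝ] (Fin d → ℝ)),
    IsSimplexWithMap p S g ∧
    ∀ j : Fin p, v j = Projectivization.mk ℝ (g (Pi.single (Fin.castLE hp j) 1))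
      (by
        simp only [ne_eq, EmbeddingLike.map_eq_zero_iff]
        intro h
        have h1 := congrFun h (Fin.castLE hp j)
        rw [Pi.single_eq_same] at h1
        exact one_ne_zero (α := ℝ) h1)

/-- `A ⊆ B` is properly embedded if the inclusion map `A ↪ B` is proper. -/
def IsProperlyEmbedded (A B : Set (PSpace d)) : Prop :=
  ∃ h : A ⊆ B, IsProperMap (Set.inclusion h)

/-- The projective action of `GL(ℝ^d)` (hence of `PGL_d(ℝ)`) on `P(ℝ^d)`. -/
def pact (g : (Fin d → ℝ) ≃ₗ[ℝ] (Fin d → ℝ)) : PSpace d → PSpace d :=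
  Projectivization.map g.toLinearMap g.injective

/-- A naive convex co-compact triple `(Ω, C, Λ)`. -/
structure NCCTriple (d : ℕ) where
  Ω : Set (PSpace d)
  C : Set (PSpace d)
  Λ : Subgroup ((Fin d → ℝ) ≃ₗ[ℝ] (Fin d → ℝ))
  isOpen_Ω : IsOpen Ω
  nonempty_Ω : Ω.Nonempty
  properlyConvex_Ω : IsProperlyConvex Ω
  inv_Ω : ∀ g ∈ Λ, pact g '' Ω = Ω
  infinite_Λ : (Λ : Set ((Fin d → ℝ) ≃ₗ[ℝ] (Fin d → ℝ))).Infinite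
  discrete_Λ : ∀ K ⊆ Ω, IsCompact K →
    {g : (Fin d → ℝ) ≃ₗ[ℝ] (Fin d → ℝ) | g ∈ Λ ∧ (pact g '' K ∩ K).Nonempty}.Finite
  C_nonempty : C.Nonempty
  C_sub : C ⊆ Ω
  C_closedInΩ : closure C ∩ Ω ⊆ C
  C_convex : Convex ℝ (cmap Ω '' C)
  inv_C : ∀ g ∈ Λ, pact g '' C = C
  cocompact : ∃ K : Set (PSpace d), K ⊆ C ∧ IsCompact K ∧ C ⊆ ⋃ g ∈ Λ, pact g '' K

/-- The orbit of a point under a subgroup of `PGL_d(ℝ)`. -/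
def porbit (Λ : Subgroup ((Fin d → ℝ) ≃ₗ[ℝ] (Fin d → ℝ))) (p : PSpace d) : Set (PSpace d) :=
  {q | ∃ g ∈ Λ, q = pact g p}

/-- The full orbital limit set `L_Ω(Λ)`. -/
def limitSet (Ω : Set (PSpace d)) (Λ : Subgroup ((Fin d → ℝ) ≃ₗ[ℝ] (Fin d → ℝ))) :
    Set (PSpace d) :=
  ⋃ p ∈ Ω, (closure (porbit Λ p) \ porbit Λ p)

/-- The convex hull of `X ⊆ closure Ω` taken inside `Ω`. -/
def convHullIn (Ω X : Set (PSpace d)) : Set (PSpace d) :=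
  {z ∈ Ω | cmap Ω z ∈ convexHull ℝ (cmap Ω '' X)}

/-- `C_Ω(Λ)`: the convex hull of the full orbital limit set in `Ω`. -/
def coreC (Ω : Set (PSpace d)) (Λ : Subgroup ((Fin d → ℝ) ≃ₗ[ℝ] (Fin d → ℝ))) :
    Set (PSpace d) :=
  convHullIn Ω (limitSet Ω Λ)

/-- A convex co-compact group `Λ ⊆ Aut(Ω)`: an infinite discrete subgroup preserving `Ω`
such that `C_Ω(Λ)` is nonempty and `Λ` acts cocompactly on it. -/
structure CCSetup (d : ℕ) where
  Ω : Set (PSpace d)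
  Λ : Subgroup ((Fin d → ℝ) ≃ₗ[ℝ] (Fin d → ℝ))
  isOpen_Ω : IsOpen Ω
  nonempty_Ω : Ω.Nonempty
  properlyConvex_Ω : IsProperlyConvex Ω
  inv_Ω : ∀ g ∈ Λ, pact g '' Ω = Ω
  infinite_Λ : (Λ : Set ((Fin d → ℝ) ≃ₗ[ℝ] (Fin d → ℝ))).Infinite
  discrete_Λ : ∀ K ⊆ Ω, IsCompact K →
    {g : (Fin d → ℝ) ≃ₗ[ℝ] (Fin d → ℝ) | g ∈ Λ ∧ (pact g '' K ∩ K).Nonempty}.Finite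
  core_nonempty : (coreC Ω Λ).Nonempty
  cocompact : ∃ K : Set (PSpace d), K ⊆ coreC Ω Λ ∧ IsCompact K ∧
    coreC Ω Λ ⊆ ⋃ g ∈ Λ, pact g '' K

/-- The Gromov product of `x, y` at `w`, with respect to the Hilbert metric of `Ω`. -/
def gromovProd (Ω : Set (PSpace d)) (w x y : PSpace d) : ℝ :=
  (hilbertDist Ω x w + hilbertDist Ω y w - hilbertDist Ω x y) / 2

/-- `(C, d_Ω)` is Gromov hyperbolic. -/
def GromovHyperbolicOn (Ω C : Set (PSpace d)) : Prop :=
  ∃ δ : ℝ, 0 ≤ δ ∧ ∀ x ∈ C, ∀ y ∈ C, ∀ z ∈ C, ∀ w ∈ C,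
    min (gromovProd Ω w x y) (gromovProd Ω w y z) - δ ≤ gromovProd Ω w x z

/-- The open Hilbert-metric ball in `Ω`. -/
def hBall (Ω : Set (PSpace d)) (x : PSpace d) (r : ℝ) : Set (PSpace d) :=
  {y ∈ Ω | hilbertDist Ω x y < r}

/-- The Hausdorff distance between `A` and `B` (w.r.t. the Hilbert metric of `Ω`)
is less than `ε`. -/
def hausLT (Ω A B : Set (PSpace d)) (ε : ℝ) : Prop :=
  (∀ a ∈ A, ∃ b ∈ B, hilbertDist Ω a b < ε) ∧ ∀ b ∈ B, ∃ a ∈ A, hilbertDist Ω a b < ε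

/-- The Hausdorff distance between `A` and `B` (w.r.t. the Hilbert metric of `Ω`)
is at most `r`. -/
def hausdorffDistLE (Ω A B : Set (PSpace d)) (r : ℝ) : Prop :=
  ∀ ε : ℝ, 0 < ε → hausLT Ω A B (r + ε)

/-- Convergence `F n → C` in the local Hausdorff topology induced by `d_Ω`. -/
def LocalHausConv (Ω : Set (PSpace d)) (F : ℕ → Set (PSpace d)) (C : Set (PSpace d)) : Prop :=
  ∀ x ∈ Ω, ∀ r : ℝ, 0 < r → ∀ ε : ℝ, 0 < ε →
    ∀ᶠ n in atTop, hausLT Ω (F n ∩ hBall Ω x r) (C ∩ hBall Ω x r) ε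

/-- A collection `𝒮` of closed subsets of `Ω` is closed and discrete in the local Hausdorff
topology: any sequence in `𝒮` converging to a nonempty closed subset of `Ω` has limit in `𝒮`
and is eventually equal to its limit. -/
def ClosedAndDiscreteInLHT (Ω : Set (PSpace d)) (𝒮 : Set (Set (PSpace d))) : Prop :=
  ∀ F : ℕ → Set (PSpace d), (∀ n, F n ∈ 𝒮) →
    ∀ C : Set (PSpace d), C.Nonempty → C ⊆ Ω → closure C ∩ Ω ⊆ C → LocalHausConv Ω F C →
      C ∈ 𝒮 ∧ ∀ᶠ n in atTop, F n = C


section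
/-- Cone data. -/
structure CS (d : ℕ) where
  P : Set (Fin d → ℝ)
  D : Set (Fin d → ℝ)
  f : (Fin d → ℝ) →ₗ[ℝ] ℝ
  N : ℝ
  P_open : IsOpen P
  P_ne : P.Nonempty
  P_add : ∀ u ∈ P, ∀ v ∈ P, u + v ∈ P
  P_smul : ∀ t : ℝ, 0 < t → ∀ v ∈ P, t • v ∈ P
  f_pos : ∀ v ∈ P, 0 < f v
  bdd : ∀ v ∈ P, ‖v‖ ≤ N * f v
  D_sub : D ⊆ P
  D_ne : D.Nonempty
  D_add : ∀ u ∈ D, ∀ v ∈ D, u + v ∈ D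
  D_smul : ∀ t : ℝ, 0 < t → ∀ v ∈ D, t • v ∈ D
  D_closed : closure D ∩ P ⊆ D
  K0 : Set (Fin d → ℝ)
  K0_cpt : IsCompact K0
  K0_sub : K0 ⊆ D
  coc : ∀ v ∈ D, ∃ g : (Fin d → ℝ) ≃ₗ[ℝ] (Fin d → ℝ), (∀ u, g u ∈ P ↔ u ∈ P) ∧
    (∀ u, g u ∈ D ↔ u ∈ D) ∧ ∃ t : ℝ, 0 < t ∧ t • g v ∈ K0

namespace CS
variable {d : ℕ} (T : CS d)

def K : Set (Fin d → ℝ) := closure T.P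

def B (r : ℝ) (u v : Fin d → ℝ) : Prop :=
  ∃ α β : ℝ, 0 < α ∧ 0 < β ∧ α • v - u ∈ T.K ∧ β • u - v ∈ T.K ∧ α * β ≤ r

lemma fc : Continuous T.f := LinearMap.continuous_of_finiteDimensional _

lemma P_sub_K : T.P ⊆ T.K := subset_closure

lemma K_closed : IsClosed T.K := isClosed_closure

lemma smul_closure {S : Set (Fin d → ℝ)} (hS : ∀ t : ℝ, 0 < t → ∀ v ∈ S, t • v ∈ S)
    {t : ℝ} (ht : 0 < t) {v : Fin d → ℝ} (hv : v ∈ closure S) : t • v ∈ closure S :=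
  map_mem_closure (continuous_const_smul t) hv (fun x hx => hS t ht x hx)

lemma add_closure {S : Set (Fin d → ℝ)} (hS : ∀ u ∈ S, ∀ v ∈ S, u + v ∈ S)
    {u v : Fin d → ℝ} (hu : u ∈ closure S) (hv : v ∈ closure S) : u + v ∈ closure S :=
  map_mem_closure₂ continuous_add hu hv hS

lemma zero_closure {S : Set (Fin d → ℝ)} (hne : S.Nonempty)
    (hS : ∀ t : ℝ, 0 < t → ∀ v ∈ S, t • v ∈ S) : (0 : Fin d → ℝ) ∈ closure S := by
  obtain ⟨v, hv⟩ := hne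
  have h : Tendsto (fun t : ℝ => t • v) (nhdsWithin 0 (Ioi 0)) (nhds ((0:ℝ) • v)) :=
    ((continuous_id.smul continuous_const).tendsto 0).mono_left nhdsWithin_le_nhds
  rw [zero_smul] at h
  refine mem_closure_of_tendsto h ?_
  filter_upwards [self_mem_nhdsWithin] with t ht using hS t ht v hv

lemma K_zero : (0 : Fin d → ℝ) ∈ T.K := zero_closure T.P_ne T.P_smul

lemma K_add {u v : Fin d → ℝ} (hu : u ∈ T.K) (hv : v ∈ T.K) : u + v ∈ T.K :=
  add_closure T.P_add hu hv

lemma K_smul {t : ℝ} (ht : 0 ≤ t) {v : Fin d → ℝ} (hv : v ∈ T.K) : t • v ∈ T.K := by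
  rcases ht.eq_or_lt with h | h
  · rw [← h, zero_smul]; exact T.K_zero
  · exact smul_closure T.P_smul h hv

lemma D_zero : (0 : Fin d → ℝ) ∈ closure T.D := zero_closure T.D_ne T.D_smul

lemma cD_smul {t : ℝ} (ht : 0 ≤ t) {v : Fin d → ℝ} (hv : v ∈ closure T.D) :
    t • v ∈ closure T.D := by
  rcases ht.eq_or_lt with h | h
  · rw [← h, zero_smul]; exact T.D_zero
  · exact smul_closure T.D_smul h hv

lemma cD_add {u v : Fin d → ℝ} (hu : u ∈ closure T.D) (hv : v ∈ closure T.D) :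
    u + v ∈ closure T.D := add_closure T.D_add hu hv

lemma cD_sub_K : closure T.D ⊆ T.K := closure_mono T.D_sub

lemma P_add_K {p k : Fin d → ℝ} (hp : p ∈ T.P) (hk : k ∈ T.K) : p + k ∈ T.P := by
  have ho : IsOpen {k' : Fin d → ℝ | p + (k - k') ∈ T.P} :=
    T.P_open.preimage (by fun_prop)
  obtain ⟨k', h1, h2⟩ := mem_closure_iff.1 hk _ ho (by simpa using hp)
  have := T.P_add _ h1 _ h2
  convert this using 1; abel

lemma f_nonneg {v : Fin d → ℝ} (hv : v ∈ T.K) : 0 ≤ T.f v := by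
  have : IsClosed {v | 0 ≤ T.f v} := isClosed_le continuous_const T.fc
  exact closure_minimal (fun v hv => (T.f_pos v hv).le) this hv

lemma bddK {v : Fin d → ℝ} (hv : v ∈ T.K) : ‖v‖ ≤ T.N * T.f v := by
  have : IsClosed {v | ‖v‖ ≤ T.N * T.f v} :=
    isClosed_le continuous_norm (continuous_const.mul T.fc)
  exact closure_minimal (fun v hv => (T.bdd v hv)) this hv

lemma f_posK {v : Fin d → ℝ} (hv : v ∈ T.K) (h0 : v ≠ 0) : 0 < T.f v := by
  rcases (T.f_nonneg hv).eq_or_lt with h | h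
  · have := T.bddK hv
    rw [← h, mul_zero] at this
    exact absurd (norm_le_zero_iff.1 this) h0
  · exact h

lemma K_smul_iff {t : ℝ} (ht : 0 < t) {v : Fin d → ℝ} : t • v ∈ T.K ↔ v ∈ T.K := by
  refine ⟨fun h => ?_, T.K_smul ht.le⟩
  have := T.K_smul (inv_pos.2 ht).le h
  rwa [smul_smul, inv_mul_cancel₀ ht.ne', one_smul] at this

lemma P_smul_iff {t : ℝ} (ht : 0 < t) {v : Fin d → ℝ} : t • v ∈ T.P ↔ v ∈ T.P := by
  refine ⟨fun h => ?_, T.P_smul t ht v⟩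
  have := T.P_smul _ (inv_pos.2 ht) _ h
  rwa [smul_smul, inv_mul_cancel₀ ht.ne', one_smul] at this

lemma D_smul_iff {t : ℝ} (ht : 0 < t) {v : Fin d → ℝ} : t • v ∈ T.D ↔ v ∈ T.D := by
  refine ⟨fun h => ?_, T.D_smul t ht v⟩
  have := T.D_smul _ (inv_pos.2 ht) _ h
  rwa [smul_smul, inv_mul_cancel₀ ht.ne', one_smul] at this

/-- absorbing -/
lemma absorb {p : Fin d → ℝ} (hp : p ∈ T.P) (u : Fin d → ℝ) :
    ∃ t : ℝ, 0 < t ∧ t • p - u ∈ T.P := by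
  have h : Tendsto (fun t : ℝ => p - t • u) (nhdsWithin 0 (Ioi 0)) (nhds (p - (0:ℝ) • u)) :=
    ((continuous_const.sub (continuous_id.smul continuous_const)).tendsto 0).mono_left
      nhdsWithin_le_nhds
  rw [zero_smul, sub_zero] at h
  obtain ⟨t, ht, ht0⟩ := ((h.eventually (T.P_open.mem_nhds hp)).and self_mem_nhdsWithin).exists
  have ht0 : 0 < t := ht0
  refine ⟨t⁻¹, inv_pos.2 ht0, ?_⟩
  have := T.P_smul _ (inv_pos.2 ht0) _ ht
  rwa [smul_sub, smul_smul, inv_mul_cancel₀ ht0.ne', one_smul] at this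

/-- if `v ∈ P` and `t u - v ∈ K` then `u ∈ P`. -/
lemma mem_P_of_dom {u v : Fin d → ℝ} {t : ℝ} (ht : 0 < t) (hv : v ∈ T.P)
    (h : t • u - v ∈ T.K) : u ∈ T.P := by
  have := T.P_add_K hv h
  rw [add_sub_cancel] at this
  exact (T.P_smul_iff ht).1 this

variable {T}

lemma B.symm {r : ℝ} {u v : Fin d → ℝ} (h : T.B r u v) : T.B r v u := by
  obtain ⟨α, β, h1, h2, h3, h4, h5⟩ := h
  exact ⟨β, α, h2, h1, h4, h3, by linarith [mul_comm α β]⟩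

lemma B.mono {r s : ℝ} {u v : Fin d → ℝ} (h : T.B r u v) (hrs : r ≤ s) : T.B s u v := by
  obtain ⟨α, β, h1, h2, h3, h4, h5⟩ := h
  exact ⟨α, β, h1, h2, h3, h4, h5.trans hrs⟩

lemma B.trans {r s : ℝ} {u v w : Fin d → ℝ} (h : T.B r u v) (h' : T.B s v w) :
    T.B (r * s) u w := by
  obtain ⟨α, β, h1, h2, h3, h4, h5⟩ := h
  obtain ⟨α', β', h1', h2', h3', h4', h5'⟩ := h'
  refine ⟨α * α', β' * β, by positivity, by positivity, ?_, ?_, ?_⟩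
  · have := T.K_add (T.K_smul h1.le h3') h3
    convert this using 1; module
  · have := T.K_add (T.K_smul h2'.le h4) h4'
    convert this using 1; module
  · calc α * α' * (β' * β) = (α * β) * (α' * β') := by ring
      _ ≤ r * s := mul_le_mul h5 h5' (by positivity) (by nlinarith [mul_pos h1 h2])

lemma B.smul_left {r t : ℝ} {u v : Fin d → ℝ} (ht : 0 < t) (h : T.B r u v) :
    T.B r (t • u) v := by
  obtain ⟨α, β, h1, h2, h3, h4, h5⟩ := h
  refine ⟨t * α, t⁻¹ * β, by positivity, by positivity, ?_, ?_, ?_⟩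
  · have := T.K_smul ht.le h3
    convert this using 1; module
  · have e : (t⁻¹ * β) • t • u = β • u := by
      rw [smul_smul]; congr 1; field_simp
    rwa [e]
  · convert h5 using 1; field_simp

lemma B.smul_right {r t : ℝ} {u v : Fin d → ℝ} (ht : 0 < t) (h : T.B r u v) :
    T.B r u (t • v) := (h.symm.smul_left ht).symm

lemma B_smul_left_iff {r t : ℝ} {u v : Fin d → ℝ} (ht : 0 < t) :
    T.B r (t • u) v ↔ T.B r u v := by
  refine ⟨fun h => ?_, B.smul_left ht⟩
  have := h.smul_left (inv_pos.2 ht)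
  rwa [smul_smul, inv_mul_cancel₀ ht.ne', one_smul] at this

lemma B_smul_right_iff {r t : ℝ} {u v : Fin d → ℝ} (ht : 0 < t) :
    T.B r u (t • v) ↔ T.B r u v :=
  ⟨fun h => ((B_smul_left_iff ht).1 h.symm).symm, B.smul_right ht⟩

lemma B_refl (u : Fin d → ℝ) : T.B 1 u u :=
  ⟨1, 1, one_pos, one_pos, by simpa using T.K_zero, by simpa using T.K_zero, by norm_num⟩

lemma B.bounds {u v : Fin d → ℝ} (hu : T.f u = 1) (hv : T.f v = 1) {α : ℝ}
    (h : α • v - u ∈ T.K) : 1 ≤ α := by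
  have := T.f_nonneg h
  simp [hu, hv] at this
  exact this

lemma B.one_le {r : ℝ} {u v : Fin d → ℝ} (hu : T.f u = 1) (hv : T.f v = 1) (h : T.B r u v) :
    1 ≤ r := by
  obtain ⟨α, β, h1, h2, h3, h4, h5⟩ := h
  have := B.bounds hu hv h3
  have := B.bounds hv hu h4
  nlinarith

variable (T)

/-- closedness of `B` -/
lemma B_closed (r : ℝ) : IsClosed {p : (Fin d → ℝ) × (Fin d → ℝ) |
    T.f p.1 = 1 ∧ T.f p.2 = 1 ∧ T.B r p.1 p.2} := by
  rw [← isSeqClosed_iff_isClosed]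
  intro p q hp hq
  choose h1 h2 α β ha hb h3 h4 h5 using hp
  have a1 : ∀ n, 1 ≤ α n := fun n => B.bounds (h1 n) (h2 n) (h3 n)
  have b1 : ∀ n, 1 ≤ β n := fun n => B.bounds (h2 n) (h1 n) (h4 n)
  have hmem : ∀ n, (α n, β n) ∈ Icc (1:ℝ) r ×ˢ Icc (1:ℝ) r := fun n =>
    ⟨⟨a1 n, by nlinarith [a1 n, b1 n, h5 n]⟩, ⟨b1 n, by nlinarith [a1 n, b1 n, h5 n]⟩⟩
  obtain ⟨⟨A, C⟩, hAC, φ, hφ, hlim⟩ := (isCompact_Icc.prod isCompact_Icc).tendsto_subseq hmem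
  have hq' := hq.comp hφ.tendsto_atTop
  have hA : Tendsto (fun n => α (φ n)) atTop (nhds A) := (continuous_fst.tendsto _).comp hlim
  have hC : Tendsto (fun n => β (φ n)) atTop (nhds C) := (continuous_snd.tendsto _).comp hlim
  have hq1 : Tendsto (fun n => (p (φ n)).1) atTop (nhds q.1) := (continuous_fst.tendsto _).comp hq'
  have hq2 : Tendsto (fun n => (p (φ n)).2) atTop (nhds q.2) := (continuous_snd.tendsto _).comp hq'
  refine ⟨?_, ?_, A, C, by linarith [hAC.1.1], by linarith [hAC.2.1], ?_, ?_, ?_⟩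
  · exact tendsto_nhds_unique ((T.fc.tendsto _).comp hq1)
      (by simp [Function.comp_def, h1])
  · exact tendsto_nhds_unique ((T.fc.tendsto _).comp hq2)
      (by simp [Function.comp_def, h2])
  · exact T.K_closed.mem_of_tendsto ((hA.smul hq2).sub hq1)
      (Eventually.of_forall fun n => h3 (φ n))
  · exact T.K_closed.mem_of_tendsto ((hC.smul hq1).sub hq2)
      (Eventually.of_forall fun n => h4 (φ n))
  · exact le_of_tendsto (hA.mul hC) (Eventually.of_forall fun n => h5 (φ n))

def nz (v : Fin d → ℝ) : Fin d → ℝ := (T.f v)⁻¹ • v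

lemma f_nz {v : Fin d → ℝ} (hv : 0 < T.f v) : T.f (T.nz v) = 1 := by
  simp [nz, hv.ne']

lemma B_tendsto {ι : Type*} {l : Filter ι} [l.NeBot] {r : ℝ} {u v : ι → Fin d → ℝ}
    {a b : Fin d → ℝ}
    (hu : Tendsto u l (nhds a)) (hv : Tendsto v l (nhds b)) (ha : 0 < T.f a) (hb : 0 < T.f b)
    (h : ∀ᶠ i in l, T.B r (u i) (v i)) : T.B r a b := by
  have fu : Tendsto (fun i => T.f (u i)) l (nhds (T.f a)) := (T.fc.tendsto _).comp hu
  have fv : Tendsto (fun i => T.f (v i)) l (nhds (T.f b)) := (T.fc.tendsto _).comp hv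
  have hu' : Tendsto (fun i => T.nz (u i)) l (nhds (T.nz a)) := (fu.inv₀ ha.ne').smul hu
  have hv' : Tendsto (fun i => T.nz (v i)) l (nhds (T.nz b)) := (fv.inv₀ hb.ne').smul hv
  have := (T.B_closed r).mem_of_tendsto (hu'.prodMk_nhds hv') (by
    filter_upwards [h, fu.eventually (lt_mem_nhds ha), fv.eventually (lt_mem_nhds hb)]
      with i h1 h2 h3
    exact ⟨T.f_nz h2, T.f_nz h3, (h1.smul_left (inv_pos.2 h2)).smul_right (inv_pos.2 h3)⟩)
  exact (B_smul_left_iff (inv_pos.2 ha)).1 ((B_smul_right_iff (inv_pos.2 hb)).1 this.2.2)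

lemma B_of_P {u v : Fin d → ℝ} (hu : u ∈ T.P) (hv : v ∈ T.P) : ∃ r, T.B r u v := by
  obtain ⟨α, h1, h2⟩ := T.absorb hv u
  obtain ⟨β, h3, h4⟩ := T.absorb hu v
  exact ⟨_, α, β, h1, h3, T.P_sub_K h2, T.P_sub_K h4, le_rfl⟩

/-- If `u ∈ P` and `B r u v` then `v ∈ P`. -/
lemma B.mem_P {T : CS d} {r : ℝ} {u v : Fin d → ℝ} (h : T.B r u v) (hu : u ∈ T.P) : v ∈ T.P := by
  obtain ⟨α, β, h1, h2, h3, h4, h5⟩ := h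
  exact T.mem_P_of_dom h1 hu h3

/-- splitting along segments -/
lemma B.split {T : CS d} {r : ℝ} {x y : Fin d → ℝ} (h : T.B r x y) {s t : ℝ} (hs : 0 ≤ s)
    (ht : 0 ≤ t) (hst : 0 < s + t) : ∃ r1 r2, T.B r1 x (s • x + t • y) ∧
      T.B r2 (s • x + t • y) y ∧ r1 * r2 ≤ r ∧ 0 < r1 ∧ 0 < r2 := by
  obtain ⟨α, β, h1, h2, h3, h4, h5⟩ := h
  have q1 : 0 < s + t * β := by
    rcases hs.eq_or_lt with h | h
    · have : 0 < t := by linarith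
      rw [← h]; positivity
    · positivity
  have q2 : 0 < s * α + t := by
    rcases ht.eq_or_lt with h | h
    · have : 0 < s := by linarith
      rw [← h]; positivity
    · positivity
  refine ⟨α / (s * α + t) * (s + t * β), (s * α + t) * (β / (s + t * β)),
    ⟨_, _, by positivity, by positivity, ?_, ?_, le_rfl⟩,
    ⟨_, _, by positivity, by positivity, ?_, ?_, le_rfl⟩, ?_, by positivity, by positivity⟩
  · have := T.K_smul (t := t / (s * α + t)) (by positivity) h3
    convert this using 1
    have e : (1 : ℝ) = α / (s * α + t) * s + t / (s * α + t) := by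
      rw [div_mul_eq_mul_div, ← add_div, eq_div_iff q2.ne']; ring
    nth_rewrite 2 [← one_smul ℝ x]
    rw [e]
    module
  · have := T.K_smul ht h4
    convert this using 1
    module
  · have := T.K_smul hs h3
    convert this using 1
    module
  · have := T.K_smul (t := s / (s + t * β)) (by positivity) h4
    convert this using 1
    have e : (1 : ℝ) = β / (s + t * β) * t + s / (s + t * β) := by
      rw [div_mul_eq_mul_div, ← add_div, eq_div_iff q1.ne']; ring
    nth_rewrite 2 [← one_smul ℝ y]
    rw [e]
    module
  · refine le_of_eq_of_le ?_ h5
    have e1 := mul_inv_cancel₀ q1.ne'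
    have e2 := mul_inv_cancel₀ q2.ne'
    rw [div_eq_mul_inv, div_eq_mul_inv]
    linear_combination (α * β * (s * α + t) * (s * α + t)⁻¹) * e1 + α * β * e2

/-- boundary cone -/
def E : Set (Fin d → ℝ) := {v | v ∈ closure T.D ∧ v ≠ 0 ∧ v ∉ T.P}

lemma E_pos {v : Fin d → ℝ} (hv : v ∈ T.E) : 0 < T.f v := T.f_posK (T.cD_sub_K hv.1) hv.2.1

def H1 : Prop := ∃ r, ∀ y ∈ T.E, ∀ z ∈ T.E, (∃ r', T.B r' y z) → T.B r y z
def H2 : Prop := ∀ y ∈ T.E, ∃ r, ∀ z ∈ T.E, (∃ r', T.B r' y z) → T.B r y z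

lemma H1_H2 (h : T.H1) : T.H2 := by
  obtain ⟨r, hr⟩ := h
  exact fun y hy => ⟨r, hr y hy⟩

end CS
end

section
namespace CS
variable {d : ℕ} (T : CS d)

lemma H2_edge (h : T.H2) {a c : Fin d → ℝ} (ha : a ∈ closure T.D) (hc : c ∈ closure T.D)
    (ha0 : a ≠ 0) (hc0 : c ≠ 0) (hac : a + c ∉ T.P) : ∃ γ : ℝ, 0 < γ ∧ γ • c - a ∈ T.K := by
  have fa := T.f_posK (T.cD_sub_K ha) ha0
  have fcc := T.f_posK (T.cD_sub_K hc) hc0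
  have hE : a + c ∈ T.E := ⟨T.cD_add ha hc, fun h0 => by
    have : T.f (a + c) = 0 := by rw [h0, map_zero]
    rw [map_add] at this; linarith, hac⟩
  obtain ⟨r, hr⟩ := h _ hE
  have key : ∀ᶠ ε in nhdsWithin (0:ℝ) (Ioi 0), T.B r (a + c) (ε • a + c) := by
    filter_upwards [Ioo_mem_nhdsGT (zero_lt_one' ℝ)] with ε hε
    refine hr _ ⟨T.cD_add (T.cD_smul hε.1.le ha) hc, fun h0 => ?_, fun hP => hac ?_⟩ ?_
    · have : T.f (ε • a + c) = 0 := by rw [h0, map_zero]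
      rw [map_add, map_smul, smul_eq_mul] at this
      nlinarith [mul_pos hε.1 fa]
    · have := T.P_add_K hP (T.K_smul (t := 1 - ε) (by linarith [hε.2]) (T.cD_sub_K ha))
      convert this using 1; module
    · refine ⟨_, ε⁻¹, 1, inv_pos.2 hε.1, one_pos, ?_, ?_, le_rfl⟩
      · have h1 : 1 ≤ ε⁻¹ := (one_le_inv₀ hε.1).2 hε.2.le
        have := T.K_smul (t := ε⁻¹ - 1) (by linarith) (T.cD_sub_K hc)
        convert this using 1
        rw [smul_add, smul_smul, inv_mul_cancel₀ hε.1.ne']; module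
      · have := T.K_smul (t := 1 - ε) (by linarith [hε.2]) (T.cD_sub_K ha)
        convert this using 1; module
  have hlim : Tendsto (fun ε : ℝ => ε • a + c) (nhdsWithin 0 (Ioi 0)) (nhds ((0:ℝ) • a + c)) :=
    (Continuous.tendsto (by fun_prop) 0).mono_left nhdsWithin_le_nhds
  rw [zero_smul, zero_add] at hlim
  have := T.B_tendsto tendsto_const_nhds hlim (T.E_pos hE) fcc key
  obtain ⟨α, β, h1, h2, h3, h4, h5⟩ := this
  refine ⟨α, h1, ?_⟩
  have := T.K_add h3 (T.cD_sub_K hc)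
  convert this using 1; abel

lemma zero_not_P : (0 : Fin d → ℝ) ∉ T.P := fun h => by
  have := T.f_pos _ h
  simp at this

def Far (r : ℝ) (w a c : Fin d → ℝ) : Prop :=
  ∀ s t : ℝ, 0 ≤ s → 0 ≤ t → s • a + t • c ∈ T.P → ¬ T.B r w (s • a + t • c)

def NoP (a c : Fin d → ℝ) : Prop := ∀ s t : ℝ, 0 ≤ s → 0 ≤ t → s • a + t • c ∉ T.P

variable {T}

lemma Far.smul {r : ℝ} {w a c : Fin d → ℝ} (h : T.Far r w a c) {x y z : ℝ} (hx : 0 < x)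
    (hy : 0 < y) (hz : 0 < z) : T.Far r (x • w) (y • a) (z • c) := by
  intro s t hs ht hP hB
  rw [B_smul_left_iff hx, smul_smul, smul_smul] at hB
  rw [smul_smul, smul_smul] at hP
  exact h _ _ (by positivity) (by positivity) hP hB

lemma K_map {g : (Fin d → ℝ) ≃ₗ[ℝ] (Fin d → ℝ)} {S : Set (Fin d → ℝ)}
    (hg : ∀ u, g u ∈ S ↔ u ∈ S) (u : Fin d → ℝ) : g u ∈ closure S ↔ u ∈ closure S := by
  have := g.toContinuousLinearEquiv.toHomeomorph.preimage_closure S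
  have e : g.toContinuousLinearEquiv.toHomeomorph ⁻¹' S = S := by
    ext v; exact hg v
  rw [e] at this
  exact Set.ext_iff.1 this u

lemma B_map {g : (Fin d → ℝ) ≃ₗ[ℝ] (Fin d → ℝ)} (hg : ∀ u, g u ∈ T.P ↔ u ∈ T.P) {r : ℝ}
    {u v : Fin d → ℝ} : T.B r (g u) (g v) ↔ T.B r u v := by
  have hK : ∀ u, g u ∈ T.K ↔ u ∈ T.K := K_map hg
  simp only [B, ← map_smul, ← map_sub, hK]

lemma Far.map {g : (Fin d → ℝ) ≃ₗ[ℝ] (Fin d → ℝ)} (hg : ∀ u, g u ∈ T.P ↔ u ∈ T.P) {r : ℝ}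
    {w a c : Fin d → ℝ} (h : T.Far r w a c) : T.Far r (g w) (g a) (g c) := by
  intro s t hs ht hP hB
  rw [← map_smul, ← map_smul, ← map_add] at hP hB
  exact h s t hs ht ((hg _).1 hP) ((B_map hg).1 hB)

lemma Far_limit {a c w : ℕ → Fin d → ℝ} {a' c' w' : Fin d → ℝ} {R : ℕ → ℝ}
    (hR : Tendsto R atTop atTop)
    (ha : Tendsto a atTop (nhds a')) (hc : Tendsto c atTop (nhds c'))
    (hw : Tendsto w atTop (nhds w')) (hwP : w' ∈ T.P) (h : ∀ n, T.Far (R n) (w n) (a n) (c n)) :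
    T.NoP a' c' := by
  intro s t hs ht hP
  obtain ⟨α, h1, h2⟩ := T.absorb hP w'
  obtain ⟨β, h3, h4⟩ := T.absorb hwP (s • a' + t • c')
  have hq : Tendsto (fun n => s • a n + t • c n) atTop (nhds (s • a' + t • c')) :=
    (ha.const_smul s).add (hc.const_smul t)
  have e1 := hq.eventually (T.P_open.mem_nhds hP)
  have e2 := ((hq.const_smul α).sub hw).eventually (T.P_open.mem_nhds h2)
  have e3 := ((hw.const_smul β).sub hq).eventually (T.P_open.mem_nhds h4)
  obtain ⟨n, g1, g2, g3, g4⟩ := (e1.and (e2.and (e3.and (hR.eventually_ge_atTop (α * β))))).exists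
  exact h n s t hs ht g1 ⟨α, β, h1, h3, T.P_sub_K g2, T.P_sub_K g3, g4⟩

variable (T)

lemma Z_compact : IsCompact {v | v ∈ closure T.D ∧ T.f v = 1} := by
  refine Metric.isCompact_of_isClosed_isBounded
    (isClosed_closure.inter (isClosed_eq T.fc continuous_const)) ?_
  refine (Metric.isBounded_closedBall (x := (0 : Fin d → ℝ)) (r := T.N)).subset ?_
  rintro v ⟨h1, h2⟩
  have := T.bddK (T.cD_sub_K h1)
  simpa [h2] using this

/-- The limit lemma. -/
lemma limit {a b c w : ℕ → Fin d → ℝ} (ha : ∀ n, a n ∈ closure T.D) (ha0 : ∀ n, a n ≠ 0)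
    (hb : ∀ n, b n ∈ closure T.D) (hb0 : ∀ n, b n ≠ 0)
    (hc : ∀ n, c n ∈ closure T.D) (hc0 : ∀ n, c n ≠ 0) (hw : ∀ n, w n ∈ T.D)
    (hconv : ∀ n, ∃ s t u : ℝ, 0 ≤ s ∧ 0 ≤ t ∧ 0 ≤ u ∧ w n = s • a n + t • b n + u • c n)
    (h1 : ∀ n : ℕ, T.Far n (w n) (a n) (c n)) (h2 : ∀ n : ℕ, T.Far n (w n) (b n) (c n)) :
    ∃ a' b' c' w' : Fin d → ℝ, a' ∈ closure T.D ∧ b' ∈ closure T.D ∧ c' ∈ closure T.D ∧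
      a' ≠ 0 ∧ b' ≠ 0 ∧ c' ≠ 0 ∧ w' ∈ T.D ∧
      (∃ s t u : ℝ, 0 ≤ s ∧ 0 ≤ t ∧ 0 ≤ u ∧ w' = s • a' + t • b' + u • c') ∧
      T.NoP a' c' ∧ T.NoP b' c' ∧ ((∀ n : ℕ, T.Far n (w n) (a n) (b n)) → T.NoP a' b') := by
  choose g gP gD τ hτ hK0 using fun n => T.coc (w n) (hw n)
  have gc : ∀ n u, g n u ∈ closure T.D ↔ u ∈ closure T.D := fun n => K_map (gD n)
  have fpos : ∀ n v, v ∈ closure T.D → v ≠ 0 → 0 < T.f (g n v) := fun n v hv h0 =>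
    T.f_posK (T.cD_sub_K ((gc n v).2 hv)) (by simpa using h0)
  have hZ : ∀ n v, v ∈ closure T.D → v ≠ 0 →
      T.nz (g n v) ∈ {v | v ∈ closure T.D ∧ T.f v = 1} := fun n v hv h0 =>
    ⟨T.cD_smul (inv_pos.2 (fpos n v hv h0)).le ((gc n v).2 hv), T.f_nz (fpos n v hv h0)⟩
  obtain ⟨M, hM⟩ := (T.K0_cpt.image T.fc).bddAbove
  choose s t u hs ht hu hwe using hconv
  set s' : ℕ → ℝ := fun n => τ n * (s n * T.f (g n (a n)))
  set t' : ℕ → ℝ := fun n => τ n * (t n * T.f (g n (b n)))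
  set u' : ℕ → ℝ := fun n => τ n * (u n * T.f (g n (c n)))
  have fa := fun n => fpos n _ (ha n) (ha0 n)
  have fb := fun n => fpos n _ (hb n) (hb0 n)
  have fcc := fun n => fpos n _ (hc n) (hc0 n)
  have hs' : ∀ n, 0 ≤ s' n := fun n =>
    mul_nonneg (hτ n).le (mul_nonneg (hs n) (fa n).le)
  have ht' : ∀ n, 0 ≤ t' n := fun n =>
    mul_nonneg (hτ n).le (mul_nonneg (ht n) (fb n).le)
  have hu' : ∀ n, 0 ≤ u' n := fun n =>
    mul_nonneg (hτ n).le (mul_nonneg (hu n) (fcc n).le)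
  have hw' : ∀ n, τ n • g n (w n) = s' n • T.nz (g n (a n)) + t' n • T.nz (g n (b n)) +
      u' n • T.nz (g n (c n)) := by
    intro n
    have aux : ∀ x (v : Fin d → ℝ), 0 < T.f v → (τ n * (x * T.f v)) • T.nz v = τ n • x • v := by
      intro x v hv
      rw [nz, smul_smul, smul_smul]; congr 1; field_simp
    simp only [s', t', u']
    rw [aux _ _ (fa n), aux _ _ (fb n), aux _ _ (fcc n), hwe n]
    simp only [map_add, map_smul, smul_add]
  have hsum : ∀ n, s' n + t' n + u' n ≤ M := by
    intro n
    have e := congrArg T.f (hw' n)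
    have := hM ⟨_, hK0 n, rfl⟩
    rw [e] at this
    simp only [map_add, map_smul, T.f_nz (fa n), T.f_nz (fb n), T.f_nz (fcc n), smul_eq_mul,
      mul_one] at this
    exact this
  have hmem : ∀ n, (((T.nz (g n (a n)), T.nz (g n (b n))), (T.nz (g n (c n)), τ n • g n (w n))),
      (s' n, t' n), u' n) ∈
      (({v | v ∈ closure T.D ∧ T.f v = 1} ×ˢ {v | v ∈ closure T.D ∧ T.f v = 1}) ×ˢ
        ({v | v ∈ closure T.D ∧ T.f v = 1} ×ˢ T.K0)) ×ˢ
        ((Icc 0 M ×ˢ Icc 0 M) ×ˢ Icc 0 M) := by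
    intro n
    refine ⟨⟨⟨hZ n _ (ha n) (ha0 n), hZ n _ (hb n) (hb0 n)⟩, hZ n _ (hc n) (hc0 n), hK0 n⟩,
      ⟨⟨hs' n, ?_⟩, ⟨ht' n, ?_⟩⟩, ⟨hu' n, ?_⟩⟩ <;>
    linarith [hs' n, ht' n, hu' n, hsum n]
  obtain ⟨⟨⟨⟨A, B⟩, ⟨C, W⟩⟩, ⟨S, S2⟩, S3⟩, hL, φ, hφ, hlim⟩ :=
    (((T.Z_compact.prod T.Z_compact).prod (T.Z_compact.prod T.K0_cpt)).prod
      ((isCompact_Icc.prod isCompact_Icc).prod isCompact_Icc)).tendsto_subseq hmem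
  obtain ⟨⟨⟨hA, hB⟩, hC, hW⟩, ⟨h3, h4⟩, h5⟩ := hL
  have hl1 := (continuous_fst.tendsto _).comp hlim
  have hl2 := (continuous_snd.tendsto _).comp hlim
  have lA : Tendsto (fun n => T.nz (g (φ n) (a (φ n)))) atTop (nhds A) :=
    ((continuous_fst.comp continuous_fst).tendsto _).comp hl1
  have lB : Tendsto (fun n => T.nz (g (φ n) (b (φ n)))) atTop (nhds B) :=
    ((continuous_snd.comp continuous_fst).tendsto _).comp hl1
  have lC : Tendsto (fun n => T.nz (g (φ n) (c (φ n)))) atTop (nhds C) :=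
    ((continuous_fst.comp continuous_snd).tendsto _).comp hl1
  have lW : Tendsto (fun n => τ (φ n) • (g (φ n) (w (φ n)))) atTop (nhds W) :=
    ((continuous_snd.comp continuous_snd).tendsto _).comp hl1
  have l1 : Tendsto (fun n => s' (φ n)) atTop (nhds S) :=
    ((continuous_fst.comp continuous_fst).tendsto _).comp hl2
  have l2 : Tendsto (fun n => t' (φ n)) atTop (nhds S2) :=
    ((continuous_snd.comp continuous_fst).tendsto _).comp hl2
  have l3 : Tendsto (fun n => u' (φ n)) atTop (nhds S3) :=
    (continuous_snd.tendsto _).comp hl2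
  have hR : Tendsto (fun n => ((φ n : ℕ) : ℝ)) atTop atTop :=
    tendsto_natCast_atTop_atTop.comp hφ.tendsto_atTop
  have hWP : W ∈ T.P := T.D_sub (T.K0_sub hW)
  have ne : ∀ v, T.f v = 1 → v ≠ 0 := by
    rintro v hv rfl; simp at hv
  refine ⟨A, B, C, W, hA.1, hB.1, hC.1, ne _ hA.2, ne _ hB.2, ne _ hC.2, T.K0_sub hW,
    ⟨S, S2, S3, h3.1, h4.1, h5.1, ?_⟩, ?_, ?_, ?_⟩
  · refine tendsto_nhds_unique lW ?_
    simp only [hw']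
    exact ((l1.smul lA).add (l2.smul lB)).add (l3.smul lC)
  · exact Far_limit hR lA lC lW hWP fun n =>
      ((h1 (φ n)).map (gP _)).smul (hτ _) (inv_pos.2 (fa _)) (inv_pos.2 (fcc _))
  · exact Far_limit hR lB lC lW hWP fun n =>
      ((h2 (φ n)).map (gP _)).smul (hτ _) (inv_pos.2 (fb _)) (inv_pos.2 (fcc _))
  · intro h
    exact Far_limit hR lA lB lW hWP fun n =>
      ((h (φ n)).map (gP _)).smul (hτ _) (inv_pos.2 (fa _)) (inv_pos.2 (fb _))

lemma NoP.add {T : CS d} {a b : Fin d → ℝ} (h : T.NoP a b) : a + b ∉ T.P := by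
  simpa using h 1 1 zero_le_one zero_le_one

lemma NoP.right {T : CS d} {a b : Fin d → ℝ} (h : T.NoP a b) : b ∉ T.P := by
  simpa using h 0 1 le_rfl zero_le_one

/-- thin triangles from H2 -/
lemma thin_of_H2 (h : T.H2) : ∃ n : ℕ, ∀ x ∈ T.D, ∀ y ∈ T.D, ∀ z ∈ T.D, ∀ s t : ℝ, 0 ≤ s → 0 ≤ t →
    s • x + t • z ∈ T.P →
    ¬ T.Far n (s • x + t • z) x y ∨ ¬ T.Far n (s • x + t • z) z y := by
  by_contra! hcon
  choose x hx y hy z hz s t hs ht hP h1 h2 using hcon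
  have ne : ∀ v ∈ T.D, v ≠ 0 := by
    rintro v hv rfl; exact T.zero_not_P (T.D_sub hv)
  obtain ⟨a, b, c, w, ha, hb, hc, ha0, hb0, hc0, hw, ⟨s, t, u, hs, ht, hu, hwe⟩, n1, n2, -⟩ :=
    T.limit (fun n => subset_closure (hx n)) (fun n => ne _ (hx n))
    (fun n => subset_closure (hz n)) (fun n => ne _ (hz n))
    (fun n => subset_closure (hy n)) (fun n => ne _ (hy n))
    (w := fun n => s n • x n + t n • z n) (fun n => T.D_closed ⟨T.cD_add
      (T.cD_smul (hs n) (subset_closure (hx n))) (T.cD_smul (ht n) (subset_closure (hz n))), hP n⟩)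
    (fun n => ⟨s n, t n, 0, hs n, ht n, le_rfl, by simp⟩) h1 h2
  obtain ⟨γ, g0, g1⟩ := T.H2_edge h ha hc ha0 hc0 n1.add
  obtain ⟨γ', g0', g1'⟩ := T.H2_edge h hb hc hb0 hc0 n2.add
  have key : (s * γ + t * γ' + u + 1) • c - w ∈ T.K := by
    have := T.K_add (T.K_add (T.K_smul hs g1) (T.K_smul ht g1')) (T.cD_sub_K hc)
    convert this using 1
    rw [hwe]; module
  exact n1.right (T.mem_P_of_dom (by positivity) (T.D_sub hw) key)

/-- seen from near a boundary point -/
lemma far_of {r : ℝ} {z x c : Fin d → ℝ} (hz : 0 < T.f z) (hzP : z ∉ T.P) (hx : x ∈ T.K)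
    (hx0 : x ≠ 0) (hc : c ∈ T.P) (h : ¬ T.B r z x) :
    ∀ᶠ ε in nhdsWithin (0:ℝ) (Ioi 0), T.Far r (z + ε • c) x c := by
  by_contra hcon
  obtain ⟨ε, hε, hF⟩ := Filter.exists_seq_forall_of_frequently (Filter.not_eventually.1 hcon)
  simp only [Far, not_forall, not_not] at hF
  choose s t hs ht hP hB using hF
  have hpos : ∀ n, 0 < s n + t n := by
    intro n
    rcases (add_nonneg (hs n) (ht n)).eq_or_lt with h0 | h0
    · have h1 : s n = 0 := by linarith [hs n, ht n]
      have h2 : t n = 0 := by linarith [hs n, ht n]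
      have := hP n
      rw [h1, h2, zero_smul, zero_smul, add_zero] at this
      exact absurd this T.zero_not_P
    · exact h0
  have hmem : ∀ n, t n / (s n + t n) ∈ Icc (0:ℝ) 1 := fun n =>
    ⟨div_nonneg (ht n) (hpos n).le, (div_le_one (hpos n)).2 (by linarith [hs n])⟩
  obtain ⟨τ, hτ, φ, hφ, hlim⟩ := isCompact_Icc.tendsto_subseq hmem
  have hε0 : Tendsto (fun n => ε (φ n)) atTop (nhds 0) :=
    (hε.mono_right nhdsWithin_le_nhds).comp hφ.tendsto_atTop
  have hB' : ∀ n, T.B r (z + ε n • c) ((1 - t n / (s n + t n)) • x + (t n / (s n + t n)) • c) := by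
    intro n
    have := (hB n).smul_right (inv_pos.2 (hpos n))
    convert this using 1
    have := (hpos n).ne'
    have e : 1 - t n / (s n + t n) = (s n + t n)⁻¹ * s n := by
      rw [inv_mul_eq_div, one_sub_div this]; congr 1; ring
    rw [smul_add, smul_smul, smul_smul, e, inv_mul_eq_div, inv_mul_eq_div]
  have fx := T.f_posK hx hx0
  have fcc := T.f_pos _ hc
  have l1 : Tendsto (fun n => z + ε (φ n) • c) atTop (nhds z) := by
    simpa using tendsto_const_nhds.add (hε0.smul_const c)
  have l2 : Tendsto (fun n => (1 - t (φ n) / (s (φ n) + t (φ n))) • x +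
      (t (φ n) / (s (φ n) + t (φ n))) • c) atTop (nhds ((1 - τ) • x + τ • c)) :=
    ((tendsto_const_nhds.sub hlim).smul_const x).add (hlim.smul_const c)
  have hfin := T.B_tendsto l1 l2 hz (by
    rw [map_add, map_smul, map_smul, smul_eq_mul, smul_eq_mul]
    rcases hτ.1.eq_or_lt with h0 | h0
    · rw [← h0]; linarith
    · nlinarith [mul_pos h0 fcc, mul_nonneg (sub_nonneg.2 hτ.2) fx.le])
    (Eventually.of_forall fun n => hB' (φ n))
  rcases hτ.1.eq_or_lt with h0 | h0
  · rw [← h0] at hfin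
    simp at hfin
    exact h hfin
  · have : (1 - τ) • x + τ • c ∈ T.P := by
      rw [add_comm]
      exact T.P_add_K (T.P_smul _ h0 _ hc) (T.K_smul (by linarith [hτ.2]) hx)
    exact hzP (hfin.symm.mem_P this)

/-- midpoint lemma -/
lemma midpt {r : ℝ} {x z : Fin d → ℝ} (hx : 0 < T.f x) (hz : 0 < T.f z) (hr : 1 ≤ r)
    (h : ¬ T.B (r * r) x z) : ∃ s t : ℝ, 0 ≤ s ∧ 0 ≤ t ∧ s + t = 1 ∧
      ¬ T.B r (s • x + t • z) x ∧ ¬ T.B r (s • x + t • z) z := by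
  by_contra! hcon
  have hfp : ∀ t ∈ Icc (0:ℝ) 1, 0 < T.f ((1 - t) • x + t • z) := by
    intro t ht
    rw [map_add, map_smul, map_smul, smul_eq_mul, smul_eq_mul]
    rcases ht.1.eq_or_lt with h0 | h0
    · rw [← h0]; linarith
    · nlinarith [mul_pos h0 hz, mul_nonneg (sub_nonneg.2 ht.2) hx.le]
  have cl : ∀ y, 0 < T.f y → IsClosed {t : ℝ | t ∈ Icc (0:ℝ) 1 ∧ T.B r ((1 - t) • x + t • z) y} := by
    intro y hy
    rw [← isSeqClosed_iff_isClosed]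
    intro t τ ht hτ
    have hm : τ ∈ Icc (0:ℝ) 1 := isClosed_Icc.mem_of_tendsto hτ (Eventually.of_forall fun n => (ht n).1)
    refine ⟨hm, T.B_tendsto (l := atTop) (u := fun n => (1 - t n) • x + t n • z) (v := fun _ => y) ?_
      tendsto_const_nhds (hfp _ hm) hy (Eventually.of_forall fun n => (ht n).2)⟩
    exact ((tendsto_const_nhds.sub hτ).smul_const x).add (hτ.smul_const z)
  have := isPreconnected_closed_iff.1 (isPreconnected_Icc (a := (0:ℝ)) (b := 1)) _ _ (cl x hx) (cl z hz)
    (fun t ht => by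
      by_cases hB : T.B r ((1 - t) • x + t • z) x
      · exact Or.inl ⟨ht, hB⟩
      · exact Or.inr ⟨ht, hcon (1 - t) t (by linarith [ht.2]) ht.1 (by ring) hB⟩)
    ⟨0, by simp, by simp, by simpa using (B_refl x).mono hr⟩
    ⟨1, by simp, by simp, by simpa using (B_refl z).mono hr⟩
  obtain ⟨t, -, ⟨-, h1⟩, -, h2⟩ := this
  exact h (h1.symm.trans h2)

def Tri : Prop := ∃ a b c : Fin d → ℝ, a ∈ closure T.D ∧ b ∈ closure T.D ∧ c ∈ closure T.D ∧
  (∃ s t u : ℝ, 0 ≤ s ∧ 0 ≤ t ∧ 0 ≤ u ∧ s • a + t • b + u • c ∈ T.P) ∧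
  T.NoP a c ∧ T.NoP b c ∧ T.NoP a b

lemma NoP_of_B {r : ℝ} {y z : Fin d → ℝ} (hy : y ∉ T.P) (h : T.B r y z) :
    T.NoP y z := by
  obtain ⟨α, β, h1, h2, h3, h4, h5⟩ := h
  intro s t hs ht hP
  have hpos : 0 < s + t * β := by
    rcases hs.eq_or_lt with h0 | h0
    · rcases ht.eq_or_lt with h0' | h0'
      · rw [← h0, ← h0', zero_smul, zero_smul, add_zero] at hP
        exact absurd hP T.zero_not_P
      · rw [← h0]; positivity
    · positivity
  refine hy (T.mem_P_of_dom hpos hP ?_)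
  have := T.K_smul ht h4
  convert this using 1; module

lemma Tri_of_not_H2 (h : ¬ T.H2) : T.Tri := by
  simp only [H2, not_forall, not_exists] at h
  obtain ⟨y, hy, h⟩ := h
  obtain ⟨c, hc⟩ := T.D_ne
  have hcP := T.D_sub hc
  have step : ∀ n : ℕ, ∃ z w : Fin d → ℝ, z ∈ closure T.D ∧ z ≠ 0 ∧ w ∈ T.D ∧
      (∃ s t u : ℝ, 0 ≤ s ∧ 0 ≤ t ∧ 0 ≤ u ∧ w = s • y + t • z + u • c) ∧
      T.Far n w y c ∧ T.Far n w z c ∧ T.Far n w y z := by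
    intro n
    obtain ⟨z, hz, ⟨r', hr'⟩, hB⟩ := h ((n + 1) * (n + 1))
    have hn : (1:ℝ) ≤ n + 1 := by
      have : (0:ℝ) ≤ n := n.cast_nonneg
      linarith
    obtain ⟨s, t, hs, ht, hst, b1, b2⟩ := T.midpt (T.E_pos hy) (T.E_pos hz) hn hB
    have hno := T.NoP_of_B hy.2.2 hr'
    have fz' : 0 < T.f (s • y + t • z) := by
      rw [map_add, map_smul, map_smul, smul_eq_mul, smul_eq_mul]
      rcases ht.eq_or_lt with h0 | h0
      · have : s = 1 := by linarith
        rw [← h0, this]; linarith [T.E_pos hy]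
      · nlinarith [mul_pos h0 (T.E_pos hz), mul_nonneg hs (T.E_pos hy).le]
    have e1 := T.far_of fz' (hno s t hs ht) (T.cD_sub_K hy.1) hy.2.1 hcP b1
    have e2 := T.far_of fz' (hno s t hs ht) (T.cD_sub_K hz.1) hz.2.1 hcP b2
    obtain ⟨ε, ⟨f1, f2⟩, hε⟩ := ((e1.and e2).and self_mem_nhdsWithin).exists
    have hε : 0 < ε := hε
    have mono : ∀ {w a c}, T.Far ((n:ℝ) + 1) w a c → T.Far n w a c :=
      fun h s t hs ht hP hB => h s t hs ht hP (hB.mono (by linarith))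
    have czz : s • y + t • z ∈ closure T.D := T.cD_add (T.cD_smul hs hy.1) (T.cD_smul ht hz.1)
    refine ⟨z, s • y + t • z + ε • c, hz.1, hz.2.1, ?_, ⟨s, t, ε, hs, ht, hε.le, rfl⟩,
      mono f1, mono f2, ?_⟩
    · refine T.D_closed ⟨T.cD_add czz (T.cD_smul hε.le (subset_closure hc)), ?_⟩
      rw [add_comm]
      exact T.P_add_K (T.P_smul _ hε _ hcP) (T.cD_sub_K czz)
    · intro s t hs ht hP
      exact absurd hP (hno s t hs ht)
  choose z w hz hz0 hw hconv h1 h2 h3 using step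
  obtain ⟨a, b, c, w, ha, hb, hc, -, -, -, hw, ⟨s, t, u, hs, ht, hu, rfl⟩, n1, n2, n3⟩ :=
    T.limit (fun _ => hy.1) (fun _ => hy.2.1) hz hz0 (c := fun _ => c)
    (fun _ => subset_closure hc) (fun _ h0 => T.zero_not_P (h0 ▸ hcP)) hw hconv h1 h2
  exact ⟨a, b, c, ha, hb, hc, ⟨s, t, u, hs, ht, hu, T.D_sub hw⟩, n1, n2, n3 h3⟩

end CS
end

section
namespace CS
variable {d : ℕ} (T : CS d)

/-- `dd` is the Hilbert metric -/
def IsDD (dd : (Fin d → ℝ) → (Fin d → ℝ) → ℝ) : Prop :=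
  ∀ u ∈ T.P, ∀ v ∈ T.P, ∀ ρ : ℝ, dd u v ≤ ρ ↔ T.B (Real.exp (2 * ρ)) u v

def gp (dd : (Fin d → ℝ) → (Fin d → ℝ) → ℝ) (w x y : Fin d → ℝ) : ℝ :=
  (dd x w + dd y w - dd x y) / 2

def H4 (dd : (Fin d → ℝ) → (Fin d → ℝ) → ℝ) : Prop :=
  ∃ δ : ℝ, 0 ≤ δ ∧ ∀ x ∈ T.D, ∀ y ∈ T.D, ∀ z ∈ T.D, ∀ w ∈ T.D,
    min (gp dd w x y) (gp dd w y z) - δ ≤ gp dd w x z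

variable {T} {dd : (Fin d → ℝ) → (Fin d → ℝ) → ℝ}

lemma IsDD.B (h : T.IsDD dd) {u v : Fin d → ℝ} (hu : u ∈ T.P) (hv : v ∈ T.P) :
    T.B (Real.exp (2 * dd u v)) u v := (h u hu v hv _).1 le_rfl

lemma IsDD.symm (h : T.IsDD dd) {u v : Fin d → ℝ} (hu : u ∈ T.P) (hv : v ∈ T.P) :
    dd u v = dd v u :=
  le_antisymm ((h u hu v hv _).2 (h.B hv hu).symm) ((h v hv u hu _).2 (h.B hu hv).symm)

lemma IsDD.tri (h : T.IsDD dd) {u v w : Fin d → ℝ} (hu : u ∈ T.P) (hv : v ∈ T.P) (hw : w ∈ T.P) :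
    dd u w ≤ dd u v + dd v w := by
  rw [h u hu w hw, mul_add, Real.exp_add]
  exact (h.B hu hv).trans (h.B hv hw)

lemma IsDD.le_log (h : T.IsDD dd) {u v : Fin d → ℝ} (hu : u ∈ T.P) (hv : v ∈ T.P) {r : ℝ}
    (hr : 0 < r) (hB : T.B r u v) : dd u v ≤ Real.log r / 2 := by
  rw [h u hu v hv, mul_div_cancel₀ _ two_ne_zero, Real.exp_log hr]
  exact hB

lemma IsDD.split (h : T.IsDD dd) {x y : Fin d → ℝ} (hx : x ∈ T.P) (hy : y ∈ T.P) {s t : ℝ}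
    (hs : 0 ≤ s) (ht : 0 ≤ t) (hp : s • x + t • y ∈ T.P) :
    dd x (s • x + t • y) + dd (s • x + t • y) y ≤ dd x y := by
  have hpos : 0 < s + t := by
    rcases (add_nonneg hs ht).eq_or_lt with h0 | h0
    · have h1 : s = 0 := by linarith
      have h2 : t = 0 := by linarith
      rw [h1, h2, zero_smul, zero_smul, add_zero] at hp
      exact absurd hp T.zero_not_P
    · exact h0
  obtain ⟨r1, r2, b1, b2, h12, p1, p2⟩ := (h.B hx hy).split hs ht hpos
  have e1 := h.le_log hx hp p1 b1
  have e2 := h.le_log hp hy p2 b2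
  have := Real.log_le_log (mul_pos p1 p2) h12
  rw [Real.log_exp, Real.log_mul p1.ne' p2.ne'] at this
  linarith

/-- Gromov product is at most the distance to a point of the side -/
lemma IsDD.gp_le (h : T.IsDD dd) {w x y : Fin d → ℝ} (hw : w ∈ T.P) (hx : x ∈ T.P) (hy : y ∈ T.P)
    {s t : ℝ} (hs : 0 ≤ s) (ht : 0 ≤ t) (hp : s • x + t • y ∈ T.P) :
    gp dd w x y ≤ dd (s • x + t • y) w := by
  have h1 := h.split hx hy hs ht hp
  have h2 := h.tri hx hp hw
  have h3 := h.tri hy hp hw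
  have h4 := h.symm hy hp
  simp only [gp]
  linarith

lemma H4_of_thin (h : T.IsDD dd) {n : ℝ} (hn : 1 ≤ n)
    (hthin : ∀ x ∈ T.D, ∀ y ∈ T.D, ∀ z ∈ T.D, ∀ s t : ℝ, 0 ≤ s → 0 ≤ t →
    s • x + t • z ∈ T.P →
    ¬ T.Far n (s • x + t • z) x y ∨ ¬ T.Far n (s • x + t • z) z y) : T.H4 dd := by
  set δ := Real.log n / 2 with hδ
  have hδ0 : 0 ≤ δ := by have := Real.log_nonneg hn; positivity
  have lg : ∀ {u v}, u ∈ T.P → v ∈ T.P → T.B n u v → dd u v ≤ δ :=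
    fun hu hv hB => h.le_log hu hv (by linarith) hB
  refine ⟨3 * δ, by positivity, fun x hx y hy z hz w hw => ?_⟩
  have hxP := T.D_sub hx
  have hyP := T.D_sub hy
  have hzP := T.D_sub hz
  have hwP := T.D_sub hw
  -- a point near both sides
  have near : ∃ t ∈ Icc (0:ℝ) 1, (1 - t) • x + t • z ∈ T.P ∧
      ¬ T.Far n ((1 - t) • x + t • z) x w ∧ ¬ T.Far n ((1 - t) • x + t • z) z w := by
    have hP : ∀ {x z : Fin d → ℝ}, x ∈ T.P → z ∈ T.P → ∀ t ∈ Icc (0:ℝ) 1,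
        (1 - t) • x + t • z ∈ T.P := by
      intro x z hxP hzP t ht
      rcases ht.1.eq_or_lt with h0 | h0
      · rw [← h0]; simpa using hxP
      · rw [add_comm]
        exact T.P_add_K (T.P_smul _ h0 _ hzP) (T.K_smul (by linarith [ht.2]) (T.P_sub_K hxP))
    have cl : ∀ y ∈ T.P, IsClosed {t : ℝ | t ∈ Icc (0:ℝ) 1 ∧ ∃ s ∈ Icc (0:ℝ) 1,
        T.B n ((1 - t) • x + t • z) ((1 - s) • y + s • w)} := by
      intro y hy
      rw [← isSeqClosed_iff_isClosed]
      intro t τ ht hτ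
      have hm : τ ∈ Icc (0:ℝ) 1 :=
        isClosed_Icc.mem_of_tendsto hτ (Eventually.of_forall fun n => (ht n).1)
      choose ht1 s hs hB using ht
      obtain ⟨σ, hσ, φ, hφ, hlim⟩ := isCompact_Icc.tendsto_subseq hs
      refine ⟨hm, σ, hσ, T.B_tendsto (l := atTop)
        (u := fun n => (1 - t (φ n)) • x + t (φ n) • z)
        (v := fun n => (1 - s (φ n)) • y + s (φ n) • w) ?_ ?_
        (T.f_pos _ (hP hxP hzP _ hm)) (T.f_pos _ (hP hy hwP _ hσ))
        (Eventually.of_forall fun n => hB (φ n))⟩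
      · have hτ' := hτ.comp hφ.tendsto_atTop
        exact ((tendsto_const_nhds.sub hτ').smul_const x).add (hτ'.smul_const z)
      · exact ((tendsto_const_nhds.sub hlim).smul_const y).add (hlim.smul_const w)
    have conv : ∀ {p y}, y ∈ T.P → ¬ T.Far n p y w → ∃ s ∈ Icc (0:ℝ) 1,
        T.B n p ((1 - s) • y + s • w) := by
      intro p y hy hF
      simp only [Far, not_forall, not_not] at hF
      obtain ⟨s, t, hs, ht, hPP, hB⟩ := hF
      have hpos : 0 < s + t := by
        rcases (add_nonneg hs ht).eq_or_lt with h0 | h0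
        · have h1 : s = 0 := by linarith
          have h2 : t = 0 := by linarith
          rw [h1, h2, zero_smul, zero_smul, add_zero] at hPP
          exact absurd hPP T.zero_not_P
        · exact h0
      refine ⟨t / (s + t), ⟨div_nonneg ht hpos.le, (div_le_one hpos).2 (by linarith)⟩, ?_⟩
      have := hB.smul_right (inv_pos.2 hpos)
      convert this using 1
      have e : 1 - t / (s + t) = (s + t)⁻¹ * s := by
        rw [inv_mul_eq_div, one_sub_div hpos.ne']; congr 1; ring
      rw [smul_add, smul_smul, smul_smul, e, inv_mul_eq_div, inv_mul_eq_div]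
    have vnoc : ∀ {p y}, y ∈ T.P → (∃ s ∈ Icc (0:ℝ) 1,
        T.B n p ((1 - s) • y + s • w)) → ¬ T.Far n p y w := by
      rintro p y hy ⟨s, hs, hB⟩ hF
      exact hF (1 - s) s (by linarith [hs.2]) hs.1 (hP hy hwP s hs) hB
    have := isPreconnected_closed_iff.1 (isPreconnected_Icc (a := (0:ℝ)) (b := 1)) _ _
      (cl x hxP) (cl z hzP)
      (fun t ht => by
        rcases hthin x hx w hw z hz (1 - t) t (by linarith [ht.2]) ht.1 (hP hxP hzP t ht) with h | h
        · exact Or.inl ⟨ht, conv hxP h⟩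
        · exact Or.inr ⟨ht, conv hzP h⟩)
      ⟨0, by simp, by simp, 0, by simp, by simpa using (B_refl x).mono hn⟩
      ⟨1, by simp, by simp, 0, by simp, by simpa using (B_refl z).mono hn⟩
    obtain ⟨t, ht, ⟨-, h1⟩, -, h2⟩ := this
    exact ⟨t, ht, hP hxP hzP t ht, vnoc hxP h1, vnoc hzP h2⟩
  obtain ⟨t, ht, hpP, n1, n2⟩ := near
  have ht' : 0 ≤ 1 - t := by linarith [ht.2]
  have hthin' := hthin x hx y hy z hz (1 - t) t ht' ht.1 hpP
  have spl := h.tri hxP hpP hzP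
  set p := (1 - t) • x + t • z with hp
  simp only [Far, not_forall, not_not] at n1 n2 hthin'
  obtain ⟨s1, t1, hs1, ht1, q1P, B1⟩ := n1
  obtain ⟨s2, t2, hs2, ht2, q2P, B2⟩ := n2
  have d1 := lg hpP q1P B1
  have d2 := lg hpP q2P B2
  have sp1 := h.split hxP hwP hs1 ht1 q1P
  have sp2 := h.split hzP hwP hs2 ht2 q2P
  set q1 := s1 • x + t1 • w
  set q2 := s2 • z + t2 • w
  have split0 := h.split hxP hzP ht' ht.1 hpP
  rw [← hp] at split0
  -- gp w x z ≥ dd p w - 2 δ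
  have low : dd p w - 2 * δ ≤ gp dd w x z := by
    have a1 := h.tri hpP q1P hwP
    have a2 := h.tri hxP q1P hpP
    have a3 := h.tri hpP q2P hwP
    have a4 := h.tri hzP q2P hpP
    have c1 := h.symm hpP q1P
    have c2 := h.symm hpP q2P
    have c3 := h.symm hpP hzP
    simp only [gp]
    linarith
  rcases hthin' with ⟨s, t, hs, ht, qP, hB⟩ | ⟨s, t, hs, ht, qP, hB⟩
  · have e1 := lg hpP qP hB
    have e2 := h.gp_le hwP hxP hyP hs ht qP
    have e3 := h.tri qP hpP hwP
    have e4 := h.symm hpP qP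
    have := min_le_left (gp dd w x y) (gp dd w y z)
    linarith
  · have e1 := lg hpP qP hB
    have e2 := h.gp_le hwP hzP hyP hs ht qP
    have e3 := h.tri qP hpP hwP
    have e4 := h.symm hpP qP
    have e5 : gp dd w y z = gp dd w z y := by
      simp only [gp]; rw [h.symm hyP hzP]; ring
    have := min_le_right (gp dd w x y) (gp dd w y z)
    linarith

lemma H2_H4 (h : T.IsDD dd) (h2 : T.H2) : T.H4 dd := by
  obtain ⟨n, hn⟩ := T.thin_of_H2 h2
  refine H4_of_thin h (n := n + 1) (by have : (0:ℝ) ≤ n := n.cast_nonneg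
                                       linarith) ?_
  intro x hx y hy z hz s t hs ht hP
  have mono : ∀ {w a c}, T.Far ((n:ℝ) + 1) w a c → T.Far n w a c :=
      fun h s t hs ht hP hB => h s t hs ht hP (hB.mono (by linarith))
  exact (hn x hx y hy z hz s t hs ht hP).imp (fun h h' => h (mono h')) (fun h h' => h (mono h'))

/-- uniform absorption -/
lemma absorb_unif {c : Fin d → ℝ} (hc : c ∈ T.P) : ∃ N : ℝ, 1 ≤ N ∧ ∀ y ∈ T.K, T.f y = 1 →
    N • c - y ∈ T.K := by
  obtain ⟨ε, hε, hball⟩ := Metric.isOpen_iff.1 T.P_open c hc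
  set M := max T.N 1
  have hM : 0 < M := by positivity
  have hM1 : 1 ≤ M := le_max_right _ _
  refine ⟨2 * M / ε + 1, by have : 0 < 2 * M / ε := by positivity
                            linarith, fun y hy hfy => ?_⟩
  have hy1 : ‖y‖ ≤ M := by
    have := T.bddK hy
    rw [hfy, mul_one] at this
    exact this.trans (le_max_left _ _)
  have hmem : c - (ε / (2 * M)) • y ∈ T.P := by
    apply hball
    rw [mem_ball_iff_norm]
    have : c - (ε / (2 * M)) • y - c = -((ε / (2 * M)) • y) := by abel
    rw [this, norm_neg, norm_smul, Real.norm_of_nonneg (by positivity)]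
    calc ε / (2 * M) * ‖y‖ ≤ ε / (2 * M) * M := by gcongr
      _ = ε / 2 := by field_simp
      _ < ε := by linarith
  have := T.K_add (T.K_smul (t := 2 * M / ε) (by positivity) (T.P_sub_K hmem)) (T.P_sub_K hc)
  convert this using 1
  rw [smul_sub, smul_smul]
  have e : 2 * M / ε * (ε / (2 * M)) = 1 := by field_simp
  rw [e]; module

lemma H4_H1 (h : T.IsDD dd) (h4 : T.H4 dd) : T.H1 := by
  obtain ⟨δ, hδ, h4⟩ := h4
  obtain ⟨c, hcD, hcP, hfc⟩ : ∃ c ∈ T.D, c ∈ T.P ∧ T.f c = 1 := by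
    obtain ⟨c, hc⟩ := T.D_ne
    have := T.f_pos _ (T.D_sub hc)
    have h' := T.D_smul _ (inv_pos.2 this) _ hc
    exact ⟨_, h', T.D_sub h', T.f_nz this⟩
  obtain ⟨N, hN1, hN⟩ := absorb_unif hcP
  set ρ := Real.log N / 2 + 4 * δ with hρ
  suffices hs : ∀ y ∈ T.E, ∀ z ∈ T.E, T.f y = 1 → T.f z = 1 → (∃ r', T.B r' y z) →
      T.B (Real.exp (2 * ρ)) y z by
    refine ⟨Real.exp (2 * ρ), ?_⟩
    rintro y hy z hz ⟨r', hr'⟩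
    have fy := T.E_pos hy
    have fz := T.E_pos hz
    have nzE : ∀ v ∈ T.E, T.nz v ∈ T.E := by
      intro v hv
      have fv := inv_pos.2 (T.E_pos hv)
      exact ⟨T.cD_smul fv.le hv.1, smul_ne_zero fv.ne' hv.2.1,
        fun hP => hv.2.2 ((T.P_smul_iff fv).1 hP)⟩
    have := hs _ (nzE y hy) _ (nzE z hz) (T.f_nz fy) (T.f_nz fz)
      ⟨r', (hr'.smul_left (inv_pos.2 fy)).smul_right (inv_pos.2 fz)⟩
    exact (B_smul_left_iff (inv_pos.2 fy)).1 ((B_smul_right_iff (inv_pos.2 fz)).1 this)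
  rintro y hy z hz fy fz ⟨r', hr'⟩
  -- points p ε = y + ε c
  have pD : ∀ v ∈ T.E, ∀ ε : ℝ, 0 < ε → v + ε • c ∈ T.D := by
    intro v hv ε hε
    refine T.D_closed ⟨T.cD_add hv.1 (T.cD_smul hε.le (subset_closure hcD)), ?_⟩
    rw [add_comm]
    exact T.P_add_K (T.P_smul _ hε _ hcP) (T.cD_sub_K hv.1)
  have pP : ∀ v ∈ T.E, ∀ ε : ℝ, 0 < ε → v + ε • c ∈ T.P := fun v hv ε hε => T.D_sub (pD v hv ε hε)
  -- distance estimates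
  have upper : ∀ v ∈ T.E, T.f v = 1 → ∀ ε : ℝ, 0 < ε →
      dd (v + ε • c) c ≤ Real.log ((N + ε) / ε) / 2 := by
    intro v hv fv ε hε
    refine h.le_log (pP v hv ε hε) hcP (by positivity)
      ⟨N + ε, ε⁻¹, by positivity, by positivity, ?_, ?_, by rw [div_eq_mul_inv]⟩
    · have := hN v (T.cD_sub_K hv.1) fv
      convert this using 1; module
    · have := T.K_smul (inv_pos.2 hε).le (T.cD_sub_K hv.1)
      convert this using 1
      rw [smul_add, smul_smul, inv_mul_cancel₀ hε.ne']; module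
  have lower : ∀ v ∈ T.E, T.f v = 1 → ∀ ε : ℝ, 0 < ε →
      Real.log ((1 + ε) / ε) / 2 ≤ dd (v + ε • c) c := by
    intro v hv fv ε hε
    obtain ⟨α, β, ha, hb, h1, h2, h3⟩ := h.B (pP v hv ε hε) hcP
    have a1 : 1 + ε ≤ α := by
      have := T.f_nonneg h1
      rw [map_sub, map_smul, map_add, map_smul, hfc, fv] at this
      simp only [smul_eq_mul] at this
      linarith
    have b1 : 1 ≤ β * ε := by
      by_contra! hlt
      apply hv.2.2
      refine T.mem_P_of_dom hb (T.P_smul _ (sub_pos.2 hlt) _ hcP) ?_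
      convert h2 using 1; module
    have : Real.log ((1 + ε) / ε) ≤ Real.log (Real.exp (2 * dd (v + ε • c) c)) := by
      refine Real.log_le_log (by positivity) (le_trans ?_ h3)
      rw [div_le_iff₀ hε]
      nlinarith
    rw [Real.log_exp] at this
    linarith
  -- upper bound for the distance between p and q
  obtain ⟨M, hM⟩ : ∃ M : ℝ, ∀ ε : ℝ, 0 < ε → dd (y + ε • c) (z + ε • c) ≤ M := by
    have hr1 := B.one_le fy fz hr'
    obtain ⟨α, β, ha, hb, h1, h2, h3⟩ := hr'
    have a1 := B.bounds fy fz h1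
    have b1 := B.bounds fz fy h2
    refine ⟨Real.log r' / 2, fun ε hε => h.le_log (pP y hy ε hε) (pP z hz ε hε) (by linarith)
      ⟨α, β, ha, hb, ?_, ?_, h3⟩⟩
    · have := T.K_add h1 (T.K_smul (t := (α - 1) * ε)
        (mul_nonneg (by linarith) hε.le) (T.P_sub_K hcP))
      convert this using 1; module
    · have := T.K_add h2 (T.K_smul (t := (β - 1) * ε)
        (mul_nonneg (by linarith) hε.le) (T.P_sub_K hcP))
      convert this using 1; module
  have main : ∀ ε : ℝ, 0 < ε → dd (y + ε • c) (z + ε • c) ≤ ρ := by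
    intro ε hε
    set A := dd (y + ε • c) c
    set A' := dd (z + ε • c) c
    obtain ⟨ε', h0, h1, h2⟩ : ∃ ε' : ℝ, 0 < ε' ∧ ε' < ε ∧
        max A A' + M ≤ Real.log ((1 + ε') / ε') / 2 := by
      set Q := max A A' + M
      refine ⟨min (ε / 2) (Real.exp (-(2 * Q))), by positivity,
        (min_le_left _ _).trans_lt (by linarith), ?_⟩
      set ε' := min (ε / 2) (Real.exp (-(2 * Q)))
      have p0 : 0 < ε' := by positivity
      have : 2 * Q ≤ Real.log ((1 + ε') / ε') := by
        rw [Real.le_log_iff_exp_le (by positivity), le_div_iff₀ p0]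
        calc Real.exp (2 * Q) * ε' ≤ Real.exp (2 * Q) * Real.exp (-(2 * Q)) := by
              gcongr; exact min_le_right _ _
          _ = 1 := by rw [← Real.exp_add]; simp
          _ ≤ 1 + ε' := by linarith
      linarith
    have M0 : 0 ≤ M := by
      have q := hM ε' h0
      have t1 := h.tri (pP y hy ε' h0) (pP z hz ε' h0) (pP y hy ε' h0)
      have t2 := h.symm (pP y hy ε' h0) (pP z hz ε' h0)
      have t3 : 0 ≤ dd (y + ε' • c) (y + ε' • c) := by
        have := h.tri (pP y hy ε' h0) (pP y hy ε' h0) (pP y hy ε' h0)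
        linarith
      linarith
    -- geodesic
    have geo : ∀ v ∈ T.E, dd (v + ε • c) c = gp dd c (v + ε • c) (v + ε' • c) ∨
        dd (v + ε • c) c ≤ gp dd c (v + ε • c) (v + ε' • c) := by
      intro v hv
      right
      have e : (1:ℝ) • (v + ε' • c) + (ε - ε') • c = v + ε • c := by module
      have := h.split (pP v hv ε' h0) hcP zero_le_one (sub_nonneg.2 h1.le)
        (by rw [e]; exact pP v hv ε hε)
      rw [e] at this
      have s := h.symm (pP v hv ε' h0) (pP v hv ε hε)
      simp only [gp]
      linarith
    have geo' : ∀ v ∈ T.E, dd (v + ε • c) c ≤ gp dd c (v + ε • c) (v + ε' • c) :=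
      fun v hv => (geo v hv).elim le_of_eq id
    have g1 := geo' y hy
    have g2 := geo' z hz
    have g2' : gp dd c (z + ε' • c) (z + ε • c) = gp dd c (z + ε • c) (z + ε' • c) := by
      simp only [gp]; rw [h.symm (pP z hz ε' h0) (pP z hz ε hε)]; ring
    have far : max A A' ≤ gp dd c (y + ε' • c) (z + ε' • c) := by
      have l1 := lower y hy fy ε' h0
      have l2 := lower z hz fz ε' h0
      have l3 := hM ε' h0
      simp only [gp]
      linarith
    have k1 := h4 _ (pD y hy ε' h0) _ (pD z hz ε' h0) _ (pD z hz ε hε) c hcD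
    have k2 := h4 _ (pD y hy ε hε) _ (pD y hy ε' h0) _ (pD z hz ε hε) c hcD
    have m1 : A' ≤ min (gp dd c (y + ε' • c) (z + ε' • c)) (gp dd c (z + ε' • c) (z + ε • c)) :=
      le_min ((le_max_right _ _).trans far) (by rw [g2']; exact g2)
    have m2 : min A A' - δ ≤ min (gp dd c (y + ε • c) (y + ε' • c))
        (gp dd c (y + ε' • c) (z + ε • c)) :=
      le_min (by linarith [min_le_left A A']) (by linarith [min_le_right A A'])
    have k3 : min A A' - 2 * δ ≤ gp dd c (y + ε • c) (z + ε • c) := by linarith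
    have u1 := upper y hy fy ε hε
    have u2 := upper z hz fz ε hε
    have l1 := lower y hy fy ε hε
    have l2 := lower z hz fz ε hε
    have lg : Real.log ((N + ε) / ε) ≤ Real.log N + Real.log ((1 + ε) / ε) := by
      rw [← Real.log_mul (by positivity) (by positivity)]
      refine Real.log_le_log (by positivity) ?_
      rw [← mul_div_assoc]
      gcongr
      nlinarith
    simp only [gp] at k3
    rcases min_choice A A' with hm | hm <;> rw [hm] at k3 <;> linarith
  have lim : ∀ v : Fin d → ℝ, Tendsto (fun ε : ℝ => v + ε • c) (nhdsWithin 0 (Ioi 0))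
      (nhds v) := by
    intro v
    have : Tendsto (fun ε : ℝ => v + ε • c) (nhdsWithin 0 (Ioi 0)) (nhds (v + (0:ℝ) • c)) :=
      (Continuous.tendsto (by fun_prop) 0).mono_left nhdsWithin_le_nhds
    simpa using this
  refine T.B_tendsto (lim y) (lim z) (by linarith) (by linarith) ?_
  filter_upwards [self_mem_nhdsWithin] with ε hε
  exact (h _ (pP y hy ε hε) _ (pP z hz ε hε) _).1 (main ε hε)

end CS
end

section
namespace CS
variable {d : ℕ} (T : CS d)

def Lf (x : Fin d → ℝ) : Set (Fin d → ℝ) := {v | ∃ r, T.B r x v}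

variable {T}

lemma Lf_K {x v : Fin d → ℝ} (hx : x ∈ T.K) (hv : v ∈ T.Lf x) : v ∈ T.K := by
  obtain ⟨r, α, β, h1, h2, h3, h4, h5⟩ := hv
  have := T.K_add h3 hx
  rw [sub_add_cancel] at this
  exact (T.K_smul_iff h1).1 this

lemma sup_char {x U W : Fin d → ℝ} (hx : x ∈ T.K) (hU : U ∈ T.Lf x) (hW : W ∈ T.Lf x)
    (hb : BddAbove {t : ℝ | U + t • (W - U) ∈ T.Lf x}) :
    ∃ tp, IsLUB {t : ℝ | U + t • (W - U) ∈ T.Lf x} tp ∧ 1 < tp ∧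
      ∀ α : ℝ, 0 < α → (α • W - U ∈ T.K ↔ tp / (tp - 1) ≤ α) := by
  set S := {t : ℝ | U + t • (W - U) ∈ T.Lf x} with hS
  have hUK := Lf_K hx hU
  have hWK := Lf_K hx hW
  obtain ⟨r1, B1⟩ := hU
  obtain ⟨r2, B2⟩ := hW
  obtain ⟨α1, β1, a1, b1, k1, k2, -⟩ := B1.symm.trans B2
  -- intermediate points
  have inter : ∀ t0 t : ℝ, 0 ≤ t → t < t0 → U + t0 • (W - U) ∈ T.K → t ∈ S := by
    intro t0 t ht htt hK
    have ht0 : 0 < t0 := lt_of_le_of_lt ht htt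
    have hpos : 0 < 1 - t / t0 := by rw [sub_pos, div_lt_one ht0]; exact htt
    refine ⟨_, B1.trans ⟨(1 - t / t0)⁻¹, t * β1 + 1, inv_pos.2 hpos, by positivity, ?_, ?_, le_rfl⟩⟩
    · have := T.K_smul (inv_pos.2 hpos).le (T.K_smul (t := t / t0) (by positivity) hK)
      convert this using 1
      have e : U + t • (W - U) = (1 - t / t0) • U + (t / t0) • (U + t0 • (W - U)) := by
        rw [smul_add, smul_smul, div_mul_cancel₀ _ ht0.ne']; module
      rw [e, smul_add, smul_smul, inv_mul_cancel₀ hpos.ne']; module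
    · have := T.K_add (T.K_smul ht k2) (T.K_smul ht hUK)
      convert this using 1; module
  have hne : S.Nonempty := ⟨0, r1, by simpa using B1⟩
  have lub := isLUB_csSup hne hb
  set tp := sSup S with htp
  have fromα : ∀ α : ℝ, 1 < α → α • W - U ∈ T.K → α / (α - 1) ≤ tp := by
    intro α h1 hK
    have hp : 0 < α - 1 := by linarith
    refine le_of_forall_lt fun t ht => ?_
    obtain ⟨t', h3, h4⟩ := exists_between ht
    have hp2 : 0 < α / (α - 1) := by positivity
    obtain ⟨t'', h5, h6⟩ := exists_between (max_lt h4 hp2)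
    have : t'' ∈ S := by
      refine inter (α / (α - 1)) _ ((le_max_right _ _).trans h5.le) h6 ?_
      have := T.K_smul (inv_pos.2 hp).le hK
      convert this using 1
      have e1 : α / (α - 1) = (α - 1)⁻¹ * α := by rw [inv_mul_eq_div]
      have e2 : 1 - (α - 1)⁻¹ * α = -(α - 1)⁻¹ := by field_simp; ring
      rw [e1]
      calc U + ((α - 1)⁻¹ * α) • (W - U) = (1 - (α - 1)⁻¹ * α) • U + ((α - 1)⁻¹ * α) • W := by
            module
        _ = _ := by rw [e2]; module
    exact h3.trans ((lt_of_le_of_lt (le_max_left _ _) h5).trans_le (lub.1 this))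
  have one_lt : ∀ α : ℝ, α • W - U ∈ T.K → 1 < α := by
    intro α hK
    by_contra! hle
    have hWU : W - U ∈ T.K := by
      have := T.K_add hK (T.K_smul (t := 1 - α) (by linarith) hWK)
      convert this using 1; module
    obtain ⟨M, hM⟩ := hb
    have := hM (inter (max M 0 + 2) (max M 0 + 1) (by positivity) (by linarith)
      (T.K_add hUK (T.K_smul (by positivity) hWU)))
    linarith [le_max_left M 0]
  have htp1 : 1 < tp := by
    have k1' : (α1 + 1) • W - U ∈ T.K := by
      have := T.K_add k1 hWK
      convert this using 1; module
    have := fromα (α1 + 1) (by linarith) k1'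
    refine lt_of_lt_of_le ?_ this
    rw [lt_div_iff₀ (by linarith)]; linarith
  have hp : 0 < tp - 1 := by linarith
  refine ⟨tp, lub, htp1, fun α ha => ⟨fun hK => ?_, fun hle => ?_⟩⟩
  · have h1 := one_lt α hK
    have h2 := fromα α h1 hK
    rw [div_le_iff₀ (by linarith)] at h2 ⊢
    linarith
  · have htpK : U + tp • (W - U) ∈ T.K := by
      have hc : tp ∈ closure S := csSup_mem_closure hne hb
      have hcl : IsClosed {t : ℝ | U + t • (W - U) ∈ T.K} :=
        T.K_closed.preimage (by fun_prop)
      have hsub : S ⊆ {t : ℝ | U + t • (W - U) ∈ T.K} := fun t ht => Lf_K hx ht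
      exact closure_minimal hsub hcl hc
    have := T.K_add (T.K_smul (inv_pos.2 hp).le htpK)
      (T.K_smul (t := α - tp / (tp - 1)) (by linarith) hWK)
    convert this using 1
    have e2 : (tp - 1)⁻¹ * tp - (tp - 1)⁻¹ = 1 := by field_simp
    have : (tp - 1)⁻¹ • (U + tp • (W - U)) + (α - tp / (tp - 1)) • W
      = α • W - ((tp - 1)⁻¹ * tp - (tp - 1)⁻¹) • U := by rw [div_eq_inv_mul]; module
    rw [this, e2, one_smul]

lemma line_bdd {O : Set (Fin d → ℝ)} (hO : Bornology.IsBounded O) {u v : Fin d → ℝ} (huv : u ≠ v) :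
    BddAbove {t : ℝ | u + t • (v - u) ∈ O} := by
  obtain ⟨R, hR⟩ := hO.exists_norm_le
  have hp : 0 < ‖v - u‖ := norm_pos_iff.2 (sub_ne_zero.2 huv.symm)
  refine ⟨(R + ‖u‖) / ‖v - u‖, fun t ht => ?_⟩
  rw [le_div_iff₀ hp]
  have h1 := hR _ ht
  have h2 : ‖t • (v - u)‖ ≤ ‖u + t • (v - u)‖ + ‖u‖ := by
    have := norm_sub_le (u + t • (v - u)) u
    simpa using this
  rw [norm_smul, Real.norm_eq_abs] at h2
  have h3 : t * ‖v - u‖ ≤ |t| * ‖v - u‖ := by gcongr; exact le_abs_self t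
  linarith

lemma hil {x : Fin d → ℝ} (hx : x ∈ T.K) (hx0 : x ≠ 0) {O : Set (Fin d → ℝ)}
    (hOb : Bornology.IsBounded O) (f' : (Fin d → ℝ) →ₗ[ℝ] ℝ) (σ : ℝ)
    (hσ : σ ≠ 0) (hO : ∀ w, w ∈ O ↔ f' w = 1 ∧ σ • w ∈ T.Lf x) {u v : Fin d → ℝ}
    (hu : u ∈ O) (hv : v ∈ O) (ρ : ℝ) :
    hilbertDistChart O u v ≤ ρ ↔ T.B (Real.exp (2 * ρ)) (σ • u) (σ • v) := by
  have hu' := (hO u).1 hu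
  have hv' := (hO v).1 hv
  unfold hilbertDistChart
  split_ifs with huv
  · subst huv
    have hUK := Lf_K hx hu'.2
    have hU0 : σ • u ≠ 0 := by
      apply smul_ne_zero hσ
      rintro rfl
      simp at hu'
    have fU := T.f_posK hUK hU0
    constructor
    · intro h
      exact (B_refl _).mono (Real.one_le_exp (by linarith))
    · intro h
      have h1 := (h.smul_left (inv_pos.2 fU)).smul_right (inv_pos.2 fU)
      have := B.one_le (T.f_nz fU) (T.f_nz fU) h1
      rw [Real.one_le_exp_iff] at this
      linarith
  · have eq1 : ∀ {u v : Fin d → ℝ}, f' u = 1 → f' v = 1 → {t : ℝ | u + t • (v - u) ∈ O} =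
        {t : ℝ | σ • u + t • (σ • v - σ • u) ∈ T.Lf x} := by
      intro u v hu hv
      ext t
      simp only [mem_setOf_eq, hO]
      have e : σ • (u + t • (v - u)) = σ • u + t • (σ • v - σ • u) := by module
      rw [e]
      simp [hu, hv]
    have b1 := line_bdd hOb huv
    have b2 := line_bdd hOb (Ne.symm huv)
    rw [eq1 hu'.1 hv'.1] at b1
    rw [eq1 hv'.1 hu'.1] at b2
    obtain ⟨tp, lub, htp, hα⟩ := sup_char hx hu'.2 hv'.2 b1
    obtain ⟨tq, lub2, htq, hβ⟩ := sup_char hx hv'.2 hu'.2 b2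
    have glb : IsGLB {t : ℝ | σ • u + t • (σ • v - σ • u) ∈ T.Lf x} (1 - tq) := by
      have flip : ∀ t : ℝ, t ∈ {t : ℝ | σ • u + t • (σ • v - σ • u) ∈ T.Lf x} ↔
          1 - t ∈ {t : ℝ | σ • v + t • (σ • u - σ • v) ∈ T.Lf x} := by
        intro t
        simp only [mem_setOf_eq]
        have : σ • u + t • (σ • v - σ • u) = σ • v + (1 - t) • (σ • u - σ • v) := by module
        rw [this]
      constructor
      · intro t ht
        have := lub2.1 ((flip t).1 ht)
        linarith
      · intro m hm
        have : tq ≤ 1 - m := lub2.2 (by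
          intro t ht
          have := hm ((flip (1 - t)).2 (by simpa using ht))
          linarith)
        linarith
    rw [eq1 hu'.1 hv'.1, lub.csSup_eq ⟨0, by simpa using hu'.2⟩,
      glb.csInf_eq ⟨0, by simpa using hu'.2⟩]
    have p1 : 0 < tp - 1 := by linarith
    have p2 : 0 < tq - 1 := by linarith
    have q1 : 0 < tp / (tp - 1) := by apply div_pos <;> linarith
    have q2 : 0 < tq / (tq - 1) := by apply div_pos <;> linarith
    have e : tp * (1 - (1 - tq)) / (-(1 - tq) * (tp - 1)) = tp / (tp - 1) * (tq / (tq - 1)) := by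
      rw [div_mul_div_comm]; congr 1 <;> ring
    rw [e]
    have e2 : 1 / 2 * Real.log (tp / (tp - 1) * (tq / (tq - 1))) ≤ ρ ↔
        Real.log (tp / (tp - 1) * (tq / (tq - 1))) ≤ 2 * ρ := by
      constructor <;> intro h <;> linarith
    rw [e2, Real.log_le_iff_le_exp (by positivity)]
    constructor
    · intro h
      exact ⟨_, _, q1, q2, (hα _ q1).2 le_rfl, (hβ _ q2).2 le_rfl, h⟩
    · rintro ⟨α, β, ha, hb, h1, h2, h3⟩
      refine le_trans ?_ h3
      exact mul_le_mul ((hα _ ha).1 h1) ((hβ _ hb).1 h2) q2.le ha.le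

/-- From a degenerate triangle to an honest one. -/
lemma Tri_nice (h : T.Tri) : ∃ v : Fin 3 → (Fin d → ℝ), LinearIndependent ℝ v ∧
    (∀ i, v i ∈ closure T.D) ∧
    (∀ S : Fin 3 → ℝ, (∀ i, 0 < S i) → ∑ i, S i • v i ∈ T.D) ∧
    (∀ S : Fin 3 → ℝ, (∀ i, 0 ≤ S i) → (∃ i, S i = 0) → ∑ i, S i • v i ∉ T.P) := by
  obtain ⟨a, b, c, ha, hb, hc, ⟨s, t, u, hs, ht, hu, hP⟩, n1, n2, n3⟩ := h
  have hbd : ∀ S : Fin 3 → ℝ, (∀ i, 0 ≤ S i) → (∃ i, S i = 0) →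
      ∑ i, S i • (![a, b, c] : Fin 3 → Fin d → ℝ) i ∉ T.P := by
    rintro S hS ⟨i, hi⟩
    rw [Fin.sum_univ_three]
    fin_cases i
    · have := n2 (S 1) (S 2) (hS 1) (hS 2)
      simp at hi
      simpa [hi] using this
    · have := n1 (S 0) (S 2) (hS 0) (hS 2)
      simp at hi
      simpa [hi] using this
    · have := n3 (S 0) (S 1) (hS 0) (hS 1)
      simp at hi
      simpa [hi] using this
  have hcl : ∀ i, (![a, b, c] : Fin 3 → Fin d → ℝ) i ∈ closure T.D := by
    intro i; fin_cases i <;> assumption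
  set v : Fin 3 → Fin d → ℝ := ![a, b, c] with hv
  obtain ⟨S, hS0, hSP⟩ : ∃ S : Fin 3 → ℝ, (∀ i, 0 ≤ S i) ∧ ∑ i, S i • v i ∈ T.P := by
    refine ⟨![s, t, u], ?_, ?_⟩
    · intro i; fin_cases i <;> assumption
    · rw [Fin.sum_univ_three]; simpa [hv] using hP
  have hS : ∀ i, 0 < S i := fun i => lt_of_le_of_ne (hS0 i)
    (fun h => hbd S hS0 ⟨i, h.symm⟩ hSP)
  have sumcl : ∀ S : Fin 3 → ℝ, (∀ i, 0 ≤ S i) → ∑ i, S i • v i ∈ closure T.D := by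
    intro S hS
    rw [Fin.sum_univ_three]
    exact T.cD_add (T.cD_add (T.cD_smul (hS 0) (hcl 0)) (T.cD_smul (hS 1) (hcl 1)))
      (T.cD_smul (hS 2) (hcl 2))
  have noneg : ∀ g : Fin 3 → ℝ, ∑ i, g i • v i = 0 → ∀ i, 0 ≤ g i := by
    intro g hg i
    by_contra! hi
    obtain ⟨j, hj, hmin⟩ := Finset.exists_min_image (Finset.univ.filter fun i => g i < 0)
      (fun i => S i / (- g i)) ⟨i, by simpa using hi⟩
    simp only [Finset.mem_filter, Finset.mem_univ, true_and] at hj hmin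
    set lam := S j / (- g j)
    have hl : 0 < lam := div_pos (hS j) (by linarith)
    refine hbd (fun i => S i + lam * g i) (fun k => ?_) ⟨j, ?_⟩ ?_
    · by_cases hk : g k < 0
      · have := hmin k hk
        rw [le_div_iff₀ (by linarith)] at this
        linarith
      · push Not at hk
        have := mul_nonneg hl.le hk
        linarith [hS k]
    · have : g j ≠ 0 := hj.ne
      simp only [lam]; field_simp; ring
    · have : ∑ i, (S i + lam * g i) • v i = ∑ i, S i • v i + lam • ∑ i, g i • v i := by
        rw [Finset.smul_sum, ← Finset.sum_add_distrib]
        congr 1; ext1 i; module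
      rw [this, hg, smul_zero, add_zero]; exact hSP
  refine ⟨v, ?_, hcl, ?_, hbd⟩
  · rw [Fintype.linearIndependent_iff]
    intro g hg i
    refine le_antisymm ?_ (noneg g hg i)
    have := noneg (fun i => - g i) (by simp [neg_smul, hg]) i
    linarith
  · intro R hR
    refine T.D_closed ⟨sumcl R fun i => (hR i).le, ?_⟩
    obtain ⟨j, -, hmin⟩ := Finset.exists_min_image Finset.univ (fun i => R i / S i)
      ⟨0, Finset.mem_univ _⟩
    have hl : 0 < R j / S j := div_pos (hR j) (hS j)
    have := T.P_add_K (T.P_smul _ hl _ hSP)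
      (T.cD_sub_K (sumcl (fun i => R i - R j / S j * S i) (fun i => by
        have := hmin i (Finset.mem_univ _)
        rw [le_div_iff₀ (hS i)] at this
        linarith)))
    convert this using 1
    rw [Finset.smul_sum, ← Finset.sum_add_distrib]
    congr 1; ext1 i; module

/-- No simplices under H2. -/
lemma no_simplex (h2 : T.H2) (g : (Fin d → ℝ) ≃ₗ[ℝ] (Fin d → ℝ)) {k : ℕ} (hk : 2 ≤ k)
    (hkd : k + 1 ≤ d) (hD : ∀ v ∈ simplexCone (d := d) (k + 1), g v ∈ T.D)
    (hcl : ∀ v, v ∈ closure (simplexCone (d := d) (k + 1)) → g v ∈ T.P →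
      v ∈ simplexCone (d := d) (k + 1)) : False := by
  have gcont : Continuous g := LinearMap.continuous_of_finiteDimensional g.toLinearMap
  have hclD : ∀ v ∈ closure (simplexCone (d := d) (k + 1)), g v ∈ closure T.D := fun v hv =>
    map_mem_closure gcont hv hD
  -- the base point
  set w : Fin d → ℝ := fun i => if (i : ℕ) < k + 1 then 1 else 0 with hw
  have hwS : w ∈ simplexCone (d := d) (k + 1) := by
    refine ⟨fun i hi => by simp only [hw]; rw [if_pos hi]; norm_num, fun i hi => ?_⟩
    have : ¬ (i : ℕ) < k + 1 := by omega
    simp only [hw]; rw [if_neg this]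
  have nonneg_cl : ∀ v : Fin d → ℝ, (∀ i : Fin d, 0 ≤ v i) →
      (∀ i : Fin d, k + 1 ≤ (i : ℕ) → v i = 0) → v ∈ closure (simplexCone (d := d) (k + 1)) := by
    intro v h1 h2
    have : Tendsto (fun ε : ℝ => v + ε • w) (nhdsWithin 0 (Ioi 0)) (nhds (v + (0:ℝ) • w)) :=
      (Continuous.tendsto (by fun_prop) 0).mono_left nhdsWithin_le_nhds
    rw [zero_smul, add_zero] at this
    refine mem_closure_of_tendsto this ?_
    filter_upwards [self_mem_nhdsWithin] with ε hε
    have hε : 0 < ε := hε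
    refine ⟨fun i hi => ?_, fun i hi => ?_⟩
    · have := mul_pos hε (hwS.1 i hi)
      simp only [Pi.add_apply, Pi.smul_apply, smul_eq_mul]
      linarith [h1 i]
    · simp [h2 i hi, hwS.2 i hi]
  set i0 : Fin d := ⟨0, by omega⟩
  set i1 : Fin d := ⟨1, by omega⟩
  set i2 : Fin d := ⟨2, by omega⟩
  have i01 : i0 ≠ i1 := by simp [i0, i1]
  have i20 : i2 ≠ i0 := by simp [i0, i2]
  have i21 : i2 ≠ i1 := by simp [i1, i2]
  set e0 : Fin d → ℝ := Pi.single i0 1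
  set e1 : Fin d → ℝ := Pi.single i1 1
  have hs : ∀ j : Fin d, (j : ℕ) < k + 1 →
      (∀ i : Fin d, 0 ≤ (Pi.single j 1 : Fin d → ℝ) i) ∧
      (∀ i : Fin d, k + 1 ≤ (i : ℕ) → (Pi.single j 1 : Fin d → ℝ) i = 0) := by
    intro j hj
    refine ⟨fun i => ?_, fun i hi => ?_⟩
    · by_cases h : i = j
      · subst h; simp
      · simp [h]
    · have : i ≠ j := by rintro rfl; omega
      simp [this]
  have hs0 := hs i0 (by simp [i0])
  have hs1 := hs i1 (by simp [i1]; omega)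
  have c0 : e0 ∈ closure (simplexCone (d := d) (k + 1)) := nonneg_cl _ hs0.1 hs0.2
  have c1 : e1 ∈ closure (simplexCone (d := d) (k + 1)) := nonneg_cl _ hs1.1 hs1.2
  have c01 : e1 + e0 ∈ closure (simplexCone (d := d) (k + 1)) :=
    nonneg_cl _ (fun i => add_nonneg (hs1.1 i) (hs0.1 i)) (fun i hi => by
      simp only [Pi.add_apply]
      have q1 : e1 i = 0 := hs1.2 i hi
      have q0 : e0 i = 0 := hs0.2 i hi
      rw [q1, q0, add_zero])
  have ne : ∀ j : Fin d, g (Pi.single j 1) ≠ 0 := by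
    intro j h
    rw [map_eq_zero_iff g g.injective] at h
    have := congrFun h j
    simp at this
  have nP : g e1 + g e0 ∉ T.P := by
    rw [← map_add]
    intro hP
    have := (hcl _ c01 hP).1 i2 (by simp [i2]; omega)
    simp [e0, e1, i20, i21] at this
  obtain ⟨γ, hγ, hK⟩ := T.H2_edge h2 (hclD _ c1) (hclD _ c0) (ne i1) (ne i0) nP
  have hP : g (w + (γ • e0 - e1)) ∈ T.P := by
    rw [map_add, map_sub, map_smul]
    exact T.P_add_K (T.D_sub (hD _ hwS)) hK
  have hcl2 : w + (γ • e0 - e1) ∈ closure (simplexCone (d := d) (k + 1)) := by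
    refine nonneg_cl _ (fun i => ?_) (fun i hi => ?_)
    · simp only [Pi.add_apply, Pi.sub_apply, Pi.smul_apply, smul_eq_mul]
      by_cases h1 : i = i1
      · subst h1
        have : w i1 = 1 := by simp [hw, i1]; omega
        have h3 : e1 i1 = 1 := by simp [e1]
        have := mul_nonneg hγ.le (hs0.1 i1)
        simp only [e0]
        linarith
      · have h3 : e1 i = 0 := by simp [e1, h1]
        have h4 := mul_nonneg hγ.le (hs0.1 i)
        have h5 : 0 ≤ w i := by simp only [hw]; split_ifs <;> norm_num
        rw [h3, sub_zero]
        exact add_nonneg h5 h4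
    · simp only [Pi.add_apply, Pi.sub_apply, Pi.smul_apply, smul_eq_mul]
      have q1 : e1 i = 0 := hs1.2 i hi
      have q0 : e0 i = 0 := hs0.2 i hi
      rw [hwS.2 i hi, q1, q0]; simp
  have := (hcl _ hcl2 hP).1 i1 (by simp [i1]; omega)
  have h4 : w i1 = 1 := by simp [hw, i1]; omega
  simp only [Pi.add_apply, Pi.sub_apply, Pi.smul_apply, smul_eq_mul] at this
  rw [h4] at this
  simp [e0, e1, i01.symm] at this

end CS

lemma exists_equiv {d : ℕ} (v : Fin 3 → (Fin d → ℝ)) (hv : LinearIndependent ℝ v) :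
    ∃ (hd : 3 ≤ d) (g : (Fin d → ℝ) ≃ₗ[ℝ] (Fin d → ℝ)),
      ∀ j : Fin 3, g (Pi.single (Fin.castLE hd j) 1) = v j := by
  have hd : 3 ≤ d := by
    have := hv.fintype_card_le_finrank
    simpa using this
  refine ⟨hd, ?_⟩
  set b := Module.Basis.sumExtend hv
  have : Finite (Module.Basis.sumExtendIndex hv) := by
    have := Module.Finite.finite_basis b
    exact Finite.of_injective (Sum.inr : _ → Fin 3 ⊕ Module.Basis.sumExtendIndex hv)
      Sum.inr_injective
  have hfin := Fintype.ofFinite (Module.Basis.sumExtendIndex hv)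
  have hcard : Fintype.card (Module.Basis.sumExtendIndex hv) = d - 3 := by
    have := Module.finrank_eq_card_basis b
    rw [Module.finrank_fin_fun, Fintype.card_sum, Fintype.card_fin] at this
    omega
  let e1 : Module.Basis.sumExtendIndex hv ≃ Fin (d - 3) := Fintype.equivFinOfCardEq hcard
  let e : Fin 3 ⊕ Module.Basis.sumExtendIndex hv ≃ Fin d :=
    ((Equiv.sumCongr (Equiv.refl (Fin 3)) e1).trans finSumFinEquiv).trans
      (finCongr (by omega))
  refine ⟨(Pi.basisFun ℝ (Fin d)).equiv (b.reindex e) (Equiv.refl _), fun j => ?_⟩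
  have h1 : (Pi.single (Fin.castLE hd j) 1 : Fin d → ℝ) = Pi.basisFun ℝ (Fin d) (Fin.castLE hd j) := by
    simp
  rw [h1, Module.Basis.equiv_apply]
  have h2 : e.symm (Fin.castLE hd j) = Sum.inl j := by
    rw [Equiv.symm_apply_eq]
    ext
    simp [e]
  simp only [Equiv.refl_apply, Module.Basis.reindex_apply, h2]
  simp [b, Module.Basis.sumExtend]
  rfl
end

section
variable {d : ℕ}

/-- Full (two-sided) cone over a subset of projective space. -/
def cone (S : Set (PSpace d)) : Set (Fin d → ℝ) := {v | ∃ h : v ≠ 0, Projectivization.mk ℝ v h ∈ S}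

lemma cone_mk {S : Set (PSpace d)} {v : Fin d → ℝ} (h : v ≠ 0) :
    v ∈ cone S ↔ Projectivization.mk ℝ v h ∈ S := ⟨fun ⟨_, h'⟩ => h', fun h' => ⟨h, h'⟩⟩

lemma cone_rep {S : Set (PSpace d)} {x : PSpace d} : x.rep ∈ cone S ↔ x ∈ S := by
  rw [cone_mk x.rep_nonzero, Projectivization.mk_rep]

lemma cone_smul {S : Set (PSpace d)} {t : ℝ} (ht : t ≠ 0) {v : Fin d → ℝ} :
    t • v ∈ cone S ↔ v ∈ cone S := by
  by_cases h : v = 0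
  · subst h; simp
  · rw [cone_mk h, cone_mk (smul_ne_zero ht h)]
    have : Projectivization.mk ℝ (t • v) (smul_ne_zero ht h) = Projectivization.mk ℝ v h := by
      rw [Projectivization.mk_eq_mk_iff']
      exact ⟨t, rfl⟩
    rw [this]

lemma cone_of_inv {U : Set (Fin d → ℝ)} (h0 : (0 : Fin d → ℝ) ∉ U)
    (hU : ∀ t : ℝ, t ≠ 0 → ∀ v ∈ U, t • v ∈ U) : cone {x : PSpace d | x.rep ∈ U} = U := by
  ext v
  constructor
  · rintro ⟨h, h'⟩
    obtain ⟨a, ha⟩ := Projectivization.exists_smul_eq_mk_rep ℝ v h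
    have h' : (Projectivization.mk ℝ v h).rep ∈ U := h'
    rw [← ha] at h'
    have := hU _ (a⁻¹).ne_zero _ h'
    rwa [← Units.smul_def, inv_smul_smul] at this
  · intro hv
    have h : v ≠ 0 := by rintro rfl; exact h0 hv
    refine ⟨h, ?_⟩
    obtain ⟨a, ha⟩ := Projectivization.exists_smul_eq_mk_rep ℝ v h
    show (Projectivization.mk ℝ v h).rep ∈ U
    rw [← ha]
    exact hU _ a.ne_zero _ hv

lemma isOpen_cone {S : Set (PSpace d)} : IsOpen S ↔ IsOpen (cone S) := by
  have h1 : IsOpen S ↔ IsOpen ((fun v : {v : Fin d → ℝ // v ≠ 0} => Projectivization.mk' ℝ v) ⁻¹' S) :=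
    Iff.rfl
  rw [h1]
  have h2 : cone S = Subtype.val '' ((fun v : {v : Fin d → ℝ // v ≠ 0} => Projectivization.mk' ℝ v) ⁻¹' S) := by
    ext v
    constructor
    · rintro ⟨h, h'⟩
      exact ⟨⟨v, h⟩, h', rfl⟩
    · rintro ⟨⟨w, hw⟩, h', rfl⟩
      exact ⟨hw, h'⟩
  have ho : IsOpen {v : Fin d → ℝ | v ≠ 0} := isOpen_ne
  rw [h2]
  exact (ho.isOpenEmbedding_subtypeVal).isOpen_iff_image_isOpen

lemma closure_cone {S : Set (PSpace d)} {v : Fin d → ℝ} (h : v ≠ 0) :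
    v ∈ closure (cone S) ↔ v ∈ cone (closure S) := by
  constructor
  · intro hv
    by_contra hn
    have ho : IsOpen (cone (closure S)ᶜ) := isOpen_cone.1 isClosed_closure.isOpen_compl
    have hv' : v ∈ cone (closure S)ᶜ := by
      rw [cone_mk h] at hn ⊢; exact hn
    obtain ⟨w, hw1, hw2⟩ := mem_closure_iff.1 hv _ ho hv'
    obtain ⟨h1, h2⟩ := hw1
    obtain ⟨h3, h4⟩ := hw2
    exact h2 (subset_closure h4)
  · intro hv
    by_contra hn
    set U : Set (Fin d → ℝ) := (closure (cone S))ᶜ ∩ {v | v ≠ 0} with hU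
    have hinv : ∀ t : ℝ, t ≠ 0 → ∀ v ∈ U, t • v ∈ U := by
      rintro t ht v ⟨h1, h2⟩
      refine ⟨fun h3 => h1 ?_, smul_ne_zero ht h2⟩
      have : t⁻¹ • (t • v) ∈ closure (cone S) :=
        map_mem_closure (continuous_const_smul t⁻¹) h3
          (fun x hx => (cone_smul (inv_ne_zero ht)).2 hx)
      rwa [inv_smul_smul₀ ht] at this
    have hc := cone_of_inv (fun h => h.2 rfl) hinv
    have hUo : IsOpen U := isClosed_closure.isOpen_compl.inter isOpen_ne
    have hW : IsOpen {x : PSpace d | x.rep ∈ U} := by rw [isOpen_cone, hc]; exact hUo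
    have hvW : v ∈ cone {x : PSpace d | x.rep ∈ U} := by rw [hc]; exact ⟨hn, h⟩
    obtain ⟨_, hvW⟩ := hvW
    obtain ⟨_, hv⟩ := hv
    obtain ⟨y, hy1, hy2⟩ := mem_closure_iff.1 hv _ hW hvW
    exact hy1.1 (subset_closure (cone_rep.2 hy2))

lemma cm_mk (f : (Fin d → ℝ) →ₗ[ℝ] ℝ) {v : Fin d → ℝ} (h : v ≠ 0) :
    chartMap f (Projectivization.mk ℝ v h) = (f v)⁻¹ • v := by
  obtain ⟨a, ha⟩ := Projectivization.exists_smul_eq_mk_rep ℝ v h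
  have ha0 : (a : ℝ) ≠ 0 := a.ne_zero
  rw [chartMap, ← ha, Units.smul_def, map_smul, smul_smul, smul_eq_mul, mul_inv]
  congr 1
  field_simp

lemma f_cm {f : (Fin d → ℝ) →ₗ[ℝ] ℝ} {x : PSpace d} (h : f x.rep ≠ 0) : f (chartMap f x) = 1 := by
  rw [chartMap, map_smul, smul_eq_mul, inv_mul_cancel₀ h]

lemma cm_ne {f : (Fin d → ℝ) →ₗ[ℝ] ℝ} {x : PSpace d} (h : f x.rep ≠ 0) : chartMap f x ≠ 0 :=
  smul_ne_zero (inv_ne_zero h) x.rep_nonzero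

lemma mk_cm {f : (Fin d → ℝ) →ₗ[ℝ] ℝ} {x : PSpace d} (h : f x.rep ≠ 0) :
    Projectivization.mk ℝ (chartMap f x) (cm_ne h) = x := by
  conv_rhs => rw [← x.mk_rep]
  rw [Projectivization.mk_eq_mk_iff']
  exact ⟨_, rfl⟩

lemma cm_cone {f : (Fin d → ℝ) →ₗ[ℝ] ℝ} {x : PSpace d} (h : f x.rep ≠ 0) {S : Set (PSpace d)} :
    chartMap f x ∈ cone S ↔ x ∈ S := by
  rw [cone_mk (cm_ne h), mk_cm h]

lemma frep_ne (f : (Fin d → ℝ) →ₗ[ℝ] ℝ) {v : Fin d → ℝ} (h : v ≠ 0) :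
    f (Projectivization.mk ℝ v h).rep ≠ 0 ↔ f v ≠ 0 := by
  obtain ⟨a, ha⟩ := Projectivization.exists_smul_eq_mk_rep ℝ v h
  rw [← ha, Units.smul_def, map_smul, smul_eq_mul]
  simp

lemma f_continuous (f : (Fin d → ℝ) →ₗ[ℝ] ℝ) : Continuous f :=
  LinearMap.continuous_of_finiteDimensional f

lemma cm_continuousOn (f : (Fin d → ℝ) →ₗ[ℝ] ℝ) :
    ContinuousOn (chartMap f) {x : PSpace d | f x.rep ≠ 0} := by
  have hc : ContinuousOn (fun v : Fin d → ℝ => (f v)⁻¹ • v) {v | f v ≠ 0} :=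
    ((f_continuous f).continuousOn.inv₀ (fun v hv => hv)).smul continuousOn_id
  have ho1 : IsOpen {v : Fin d → ℝ | f v ≠ 0} := isOpen_ne_fun (f_continuous f) continuous_const
  have key : ∀ U : Set (Fin d → ℝ), IsOpen U →
      IsOpen ({x : PSpace d | f x.rep ≠ 0} ∩ chartMap f ⁻¹' U) := by
    intro U hU
    rw [isOpen_cone]
    have := hc.isOpen_inter_preimage ho1 hU
    convert this using 1
    ext v
    constructor
    · rintro ⟨h, h1, h2⟩
      have h1 := (frep_ne f h).1 h1
      have h2 : chartMap f (Projectivization.mk ℝ v h) ∈ U := h2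
      rw [cm_mk f h] at h2
      exact ⟨h1, h2⟩
    · rintro ⟨h1, h2⟩
      have h1 : f v ≠ 0 := h1
      have h : v ≠ 0 := by rintro rfl; simp at h1
      refine ⟨h, (frep_ne f h).2 h1, ?_⟩
      show chartMap f (Projectivization.mk ℝ v h) ∈ U
      rw [cm_mk f h]; exact h2
  have ho : IsOpen {x : PSpace d | f x.rep ≠ 0} := by simpa using key univ isOpen_univ
  rw [continuousOn_open_iff ho]
  exact key

/-- The positive cone. -/
def pc (f : (Fin d → ℝ) →ₗ[ℝ] ℝ) (S : Set (PSpace d)) : Set (Fin d → ℝ) := {v | v ∈ cone S ∧ 0 < f v}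

lemma pc_iff {f : (Fin d → ℝ) →ₗ[ℝ] ℝ} {S : Set (PSpace d)} {v : Fin d → ℝ} (hv : 0 < f v) :
    v ∈ cone S ↔ (f v)⁻¹ • v ∈ chartMap f '' S := by
  have h : v ≠ 0 := by rintro rfl; simp at hv
  constructor
  · rintro ⟨_, h'⟩
    exact ⟨_, h', cm_mk f h⟩
  · rintro ⟨x, hx, he⟩
    have h1 : (f v)⁻¹ • v ≠ 0 := smul_ne_zero (inv_ne_zero hv.ne') h
    have hne : (f x.rep)⁻¹ ≠ 0 := by
      intro h2
      rw [chartMap, h2, zero_smul] at he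
      exact h1 he.symm
    rw [← cone_smul (inv_ne_zero hv.ne'), ← he, chartMap, cone_smul hne, cone_rep]
    exact hx

lemma pc_smul {f : (Fin d → ℝ) →ₗ[ℝ] ℝ} {S : Set (PSpace d)} : ∀ t : ℝ, 0 < t → ∀ v ∈ pc f S, t • v ∈ pc f S := by
  rintro t ht v ⟨h1, h2⟩
  refine ⟨(cone_smul ht.ne').2 h1, ?_⟩
  rw [map_smul, smul_eq_mul]; positivity

lemma pc_add {f : (Fin d → ℝ) →ₗ[ℝ] ℝ} {S : Set (PSpace d)} (hc : Convex ℝ (chartMap f '' S)) :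
    ∀ u ∈ pc f S, ∀ v ∈ pc f S, u + v ∈ pc f S := by
  rintro u ⟨h1, h2⟩ v ⟨h3, h4⟩
  have hp : 0 < f (u + v) := by rw [map_add]; linarith
  refine ⟨?_, hp⟩
  rw [pc_iff hp]
  rw [pc_iff h2] at h1
  rw [pc_iff h4] at h3
  have := hc h1 h3 (a := f u / f (u + v)) (b := f v / f (u + v)) (by positivity) (by positivity)
    (by rw [← add_div, ← map_add, div_self hp.ne'])
  convert this using 1
  rw [smul_smul, smul_smul, smul_add]
  congr 2 <;> field_simp

lemma pc_closure {f : (Fin d → ℝ) →ₗ[ℝ] ℝ} {S : Set (PSpace d)} {v : Fin d → ℝ} (hv : 0 < f v) :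
    v ∈ closure (pc f S) ↔ v ∈ cone (closure S) := by
  have h : v ≠ 0 := by rintro rfl; simp at hv
  rw [← closure_cone h]
  have ho : IsOpen {v : Fin d → ℝ | 0 < f v} := isOpen_lt continuous_const (f_continuous f)
  constructor
  · intro h'
    exact closure_mono (fun x hx => hx.1) h'
  · intro h'
    have := ho.inter_closure (t := cone S) ⟨hv, h'⟩
    refine closure_mono ?_ this
    rintro x ⟨h1, h2⟩
    exact ⟨h2, h1⟩

lemma sign_const {L : Set (Fin d → ℝ)} (ha : ∀ u ∈ L, ∀ v ∈ L, u + v ∈ L)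
    (hs : ∀ t : ℝ, 0 < t → ∀ v ∈ L, t • v ∈ L) (h : (Fin d → ℝ) →ₗ[ℝ] ℝ) (h0 : ∀ v ∈ L, h v ≠ 0) :
    ∃ σ : ℝ, (σ = 1 ∨ σ = -1) ∧ ∀ v ∈ L, 0 < σ * h v := by
  by_cases hp : ∀ v ∈ L, 0 < h v
  · exact ⟨1, Or.inl rfl, fun v hv => by simpa using hp v hv⟩
  · push Not at hp
    obtain ⟨u, hu, hu'⟩ := hp
    have hu' : h u < 0 := lt_of_le_of_ne hu' (h0 u hu)
    refine ⟨-1, Or.inr rfl, fun v hv => ?_⟩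
    by_contra! hn
    have hv' : 0 < h v := lt_of_le_of_ne (by linarith) (h0 v hv).symm
    refine h0 _ (ha _ (hs (- h u) (by linarith) v hv) _ (hs (h v) hv' u hu)) ?_
    simp only [map_add, map_smul, smul_eq_mul]; ring

lemma chartOf_spec {S : Set (PSpace d)} (h : IsProperlyConvex S) :
    (∀ x ∈ closure S, chartOf S x.rep ≠ 0) ∧
    Convex ℝ (chartMap (chartOf S) '' S) ∧ Bornology.IsBounded (chartMap (chartOf S) '' S) := by
  unfold chartOf
  rw [dif_pos h]
  exact h.choose_spec
end

section
variable {d : ℕ}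

namespace NCCTriple
variable (T : NCCTriple d)

def fT : (Fin d → ℝ) →ₗ[ℝ] ℝ := chartOf T.Ω

lemma spec : (∀ x ∈ closure T.Ω, T.fT x.rep ≠ 0) ∧
    Convex ℝ (chartMap T.fT '' T.Ω) ∧ Bornology.IsBounded (chartMap T.fT '' T.Ω) :=
  chartOf_spec T.properlyConvex_Ω

lemma frep {x : PSpace d} (hx : x ∈ T.Ω) : T.fT x.rep ≠ 0 := T.spec.1 x (subset_closure hx)

lemma pact_cone {g : (Fin d → ℝ) ≃ₗ[ℝ] (Fin d → ℝ)} {S : Set (PSpace d)}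
    (h : pact g '' S = S) (v : Fin d → ℝ) : g v ∈ cone S ↔ v ∈ cone S := by
  by_cases h0 : v = 0
  · subst h0; simp
  have h1 : g v ≠ 0 := by simpa using h0
  rw [cone_mk h0, cone_mk h1]
  have e : Projectivization.mk ℝ (g v) h1 = pact g (Projectivization.mk ℝ v h0) := by
    rw [pact, Projectivization.map_mk]; rfl
  rw [e]
  have inj : Function.Injective (pact g) := Projectivization.map_injective _ _
  conv_lhs => rw [← h]
  rw [inj.mem_set_image]

lemma P_add' : ∀ u ∈ pc T.fT T.Ω, ∀ v ∈ pc T.fT T.Ω, u + v ∈ pc T.fT T.Ω := pc_add T.spec.2.1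

lemma cone_ne {v : Fin d → ℝ} (hv : v ∈ cone T.Ω) : T.fT v ≠ 0 := by
  obtain ⟨h, h'⟩ := hv
  exact (frep_ne _ h).1 (T.frep h')

lemma grp {g : (Fin d → ℝ) ≃ₗ[ℝ] (Fin d → ℝ)} (hg : g ∈ T.Λ) :
    ∃ g' : (Fin d → ℝ) ≃ₗ[ℝ] (Fin d → ℝ), (∃ σ : ℝ, σ ≠ 0 ∧ ∀ v, g' v = σ • g v) ∧
      (∀ u, g' u ∈ pc T.fT T.Ω ↔ u ∈ pc T.fT T.Ω) ∧
      (∀ u, g' u ∈ pc T.fT T.C ↔ u ∈ pc T.fT T.C) := by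
  have hΩ := pact_cone (T.inv_Ω g hg)
  have hC := pact_cone (T.inv_C g hg)
  obtain ⟨σ, hσ, hpos⟩ := sign_const T.P_add' pc_smul (T.fT ∘ₗ g.toLinearMap)
    (fun v hv => T.cone_ne ((hΩ v).2 hv.1))
  have hσ0 : σ ≠ 0 := by rcases hσ with h | h <;> rw [h] <;> norm_num
  obtain ⟨g', hg'⟩ : ∃ g' : (Fin d → ℝ) ≃ₗ[ℝ] (Fin d → ℝ), ∀ v, g' v = σ • g v := by
    rcases hσ with h | h
    · exact ⟨g, fun v => by rw [h, one_smul]⟩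
    · exact ⟨g.trans (LinearEquiv.neg ℝ), fun v => by rw [h]; simp⟩
  have hpos' : ∀ v ∈ pc T.fT T.Ω, 0 < T.fT (g' v) := by
    intro v hv
    rw [hg', map_smul, smul_eq_mul]
    exact hpos v hv
  have hcone : ∀ {S : Set (PSpace d)}, (∀ v, g v ∈ cone S ↔ v ∈ cone S) → ∀ v, g' v ∈ cone S ↔ v ∈ cone S := by
    intro S hS v
    rw [hg', cone_smul hσ0, hS]
  have hback : ∀ u, u ∈ cone T.Ω → 0 < T.fT (g' u) → 0 < T.fT u := by
    intro u hu h1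
    by_contra hn
    have hlt : T.fT u < 0 := lt_of_le_of_ne (not_lt.1 hn) (T.cone_ne hu)
    have : -u ∈ pc T.fT T.Ω := by
      refine ⟨?_, by rw [map_neg]; linarith⟩
      rw [← neg_one_smul ℝ u, cone_smul (by norm_num)]; exact hu
    have := hpos' _ this
    rw [map_neg, map_neg] at this
    linarith
  have hsub : ∀ {u}, u ∈ cone T.C → u ∈ cone T.Ω := fun ⟨h, h'⟩ => ⟨h, T.C_sub h'⟩
  refine ⟨g', ⟨σ, hσ0, hg'⟩, fun u => ⟨fun h => ?_, fun h => ?_⟩, fun u => ⟨fun h => ?_, fun h => ?_⟩⟩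
  · have := (hcone hΩ u).1 h.1
    exact ⟨this, hback _ this h.2⟩
  · exact ⟨(hcone hΩ u).2 h.1, hpos' _ h⟩
  · have := (hcone hC u).1 h.1
    exact ⟨this, hback _ (hsub this) h.2⟩
  · exact ⟨(hcone hC u).2 h.1, hpos' _ ⟨hsub h.1, h.2⟩⟩

lemma cm_pc {x : PSpace d} {S : Set (PSpace d)} (h : T.fT x.rep ≠ 0) (hx : x ∈ S) :
    chartMap T.fT x ∈ pc T.fT S :=
  ⟨(cm_cone h).2 hx, by rw [f_cm h]; norm_num⟩

def toCS : CS d where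
  P := pc T.fT T.Ω
  D := pc T.fT T.C
  f := T.fT
  N := T.spec.2.2.exists_norm_le.choose
  P_open := (isOpen_cone.1 T.isOpen_Ω).inter (isOpen_lt continuous_const (f_continuous T.fT))
  P_ne := by
    obtain ⟨x, hx⟩ := T.nonempty_Ω
    exact ⟨_, T.cm_pc (T.frep hx) hx⟩
  P_add := T.P_add'
  P_smul := pc_smul
  f_pos := fun v hv => hv.2
  bdd := by
    intro v hv
    have h := T.spec.2.2.exists_norm_le.choose_spec _ ((pc_iff hv.2).1 hv.1)
    rw [norm_smul, norm_inv, Real.norm_eq_abs, abs_of_pos hv.2, inv_mul_le_iff₀ hv.2] at h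
    linarith
  D_sub := fun v hv => ⟨⟨hv.1.1, T.C_sub hv.1.2⟩, hv.2⟩
  D_ne := by
    obtain ⟨x, hx⟩ := T.C_nonempty
    exact ⟨_, T.cm_pc (T.frep (T.C_sub hx)) hx⟩
  D_add := pc_add T.C_convex
  D_smul := pc_smul
  D_closed := by
    rintro v ⟨h1, h2⟩
    rw [pc_closure h2.2] at h1
    exact ⟨⟨h1.1, T.C_closedInΩ ⟨h1.2, h2.1.2⟩⟩, h2.2⟩
  K0 := chartMap T.fT '' T.cocompact.choose
  K0_cpt := T.cocompact.choose_spec.2.1.image_of_continuousOn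
    ((cm_continuousOn T.fT).mono fun x hx => T.frep (T.C_sub (T.cocompact.choose_spec.1 hx)))
  K0_sub := by
    rintro _ ⟨x, hx, rfl⟩
    have := T.cocompact.choose_spec.1 hx
    exact T.cm_pc (T.frep (T.C_sub this)) this
  coc := by
    rintro v ⟨⟨h0, hv⟩, hfv⟩
    have := T.cocompact.choose_spec.2.2 hv
    simp only [mem_iUnion] at this
    obtain ⟨g, hg, k, hk, hgk⟩ := this
    obtain ⟨g', ⟨σ, hσ, hg'⟩, hP, hD⟩ := T.grp (T.Λ.inv_mem hg)
    have hD' := (hD v).2 ⟨⟨h0, hv⟩, hfv⟩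
    refine ⟨g', hP, hD, (T.fT (g' v))⁻¹, inv_pos.2 hD'.2, k, hk, ?_⟩
    have hne : g' v ≠ 0 := by simpa using h0
    rw [← cm_mk T.fT hne]
    congr 1
    induction k using Projectivization.ind with
    | h w hw =>
      rw [pact, Projectivization.map_mk, Projectivization.mk_eq_mk_iff'] at hgk
      obtain ⟨a, ha⟩ := hgk
      have ha : a • v = g w := ha
      rw [Projectivization.mk_eq_mk_iff']
      refine ⟨a * σ⁻¹, ?_⟩
      rw [hg', smul_smul, mul_assoc, inv_mul_cancel₀ hσ, mul_one]
      have e : (g⁻¹ : (Fin d → ℝ) ≃ₗ[ℝ] (Fin d → ℝ)) (a • v) = w := by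
        rw [ha]; exact g.symm_apply_apply w
      rw [← e, map_smul]

end NCCTriple
end

section
variable {d : ℕ}

lemma im_iff {f : (Fin d → ℝ) →ₗ[ℝ] ℝ} {S : Set (PSpace d)} (hS : ∀ x ∈ S, f x.rep ≠ 0)
    (w : Fin d → ℝ) : w ∈ chartMap f '' S ↔ f w = 1 ∧ w ∈ cone S := by
  constructor
  · rintro ⟨x, hx, rfl⟩
    exact ⟨f_cm (hS x hx), (cm_cone (hS x hx)).2 hx⟩
  · rintro ⟨h1, h2⟩
    have := (pc_iff (f := f) (by rw [h1]; norm_num)).1 h2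
    rwa [h1, inv_one, one_smul] at this

namespace CS
variable {Q : CS d}

lemma Lf_add {x u v : Fin d → ℝ} (hx : x ∈ Q.K) (hu : u ∈ Q.Lf x) (hv : v ∈ Q.Lf x) :
    u + v ∈ Q.Lf x := by
  have hvK := Lf_K hx hv
  obtain ⟨r1, α1, β1, a1, b1, k1, l1, -⟩ := hu
  obtain ⟨r2, α2, β2, a2, b2, k2, l2, -⟩ := hv
  refine ⟨_, α1, β1 + β2, a1, by positivity, ?_, ?_, le_rfl⟩
  · have := Q.K_add k1 (Q.K_smul a1.le hvK)
    convert this using 1; module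
  · have := Q.K_add l1 l2
    convert this using 1; module

lemma Lf_smul {x v : Fin d → ℝ} {t : ℝ} (ht : 0 < t) (hv : v ∈ Q.Lf x) : t • v ∈ Q.Lf x := by
  obtain ⟨r, hr⟩ := hv
  exact ⟨r, hr.smul_right ht⟩

lemma Lf_ne {x v : Fin d → ℝ} (hx : x ∈ Q.K) (hx0 : x ≠ 0) (hv : v ∈ Q.Lf x) : v ≠ 0 := by
  rintro rfl
  obtain ⟨r1, α1, β1, a1, b1, k1, l1, -⟩ := hv
  have h1 := Q.f_posK hx hx0
  have h2 := Q.f_nonneg k1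
  simp at h2
  linarith

lemma B_of_seg {a b : Fin d → ℝ} (ha : a ∈ Q.K) (hb : b ∈ Q.K) {s t s' t' : ℝ} (hs : 0 < s)
    (ht : 0 < t) (hs' : 0 < s') (ht' : 0 < t') :
    ∃ r, Q.B r (s • a + t • b) (s' • a + t' • b) := by
  have aux : ∀ {s t s' t' : ℝ}, 0 < s → 0 < t → 0 < s' → 0 < t' →
      (s / s' + t / t') • (s' • a + t' • b) - (s • a + t • b) ∈ Q.K := by
    intro s t s' t' hs ht hs' ht'
    have := Q.K_add (Q.K_smul (t := t / t' * s') (by positivity) ha)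
      (Q.K_smul (t := s / s' * t') (by positivity) hb)
    convert this using 1
    have e1 : s / s' * s' = s := by field_simp
    have e2 : t / t' * t' = t := by field_simp
    calc _ = (s / s' * s' + t / t' * s' - s) • a + (s / s' * t' + t / t' * t' - t) • b := by module
      _ = _ := by rw [e1, e2]; module
  exact ⟨_, _, _, by positivity, by positivity, aux hs ht hs' ht', aux hs' ht' hs ht, le_rfl⟩

end CS

namespace NCCTriple
variable (T : NCCTriple d)

/-- normalized lift -/
def hat (x : PSpace d) : Fin d → ℝ := chartMap T.fT x

variable {T}

lemma K_iff {v : Fin d → ℝ} (hv : 0 < T.fT v) : v ∈ T.toCS.K ↔ v ∈ cone (closure T.Ω) := pc_closure hv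

lemma f_hat {x : PSpace d} (hx : x ∈ closure T.Ω) : T.fT (T.hat x) = 1 := f_cm (T.spec.1 x hx)

lemma hat_ne {x : PSpace d} (hx : x ∈ closure T.Ω) : T.hat x ≠ 0 := cm_ne (T.spec.1 x hx)

lemma hat_K {x : PSpace d} (hx : x ∈ closure T.Ω) : T.hat x ∈ T.toCS.K := by
  rw [K_iff (by rw [f_hat hx]; norm_num)]
  exact (cm_cone (T.spec.1 x hx)).2 hx

lemma hat_inj {x y : PSpace d} (hx : x ∈ closure T.Ω) (hy : y ∈ closure T.Ω) (h : T.hat x = T.hat y) :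
    x = y := by
  have h1 := mk_cm (T.spec.1 x hx)
  have h2 := mk_cm (T.spec.1 y hy)
  rw [← h1, ← h2]
  congr 1

lemma exists_of_K {v : Fin d → ℝ} (hv : v ∈ T.toCS.K) (h1 : T.fT v = 1) :
    ∃ x ∈ closure T.Ω, T.hat x = v := by
  have h := (K_iff (T := T) (v := v) (by rw [h1]; norm_num)).1 hv
  obtain ⟨h0, h⟩ := h
  refine ⟨_, h, ?_⟩
  rw [hat, cm_mk, h1, inv_one, one_smul]

lemma face_iff {x y : PSpace d} (hx : x ∈ closure T.Ω) :
    y ∈ face T.Ω x ↔ y ∈ closure T.Ω ∧ ∃ r, T.toCS.B r (T.hat x) (T.hat y) := by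
  constructor
  · rintro (rfl | ⟨hy, a, ha, b, hb, ⟨_, s, t, hs, ht, hst, e1⟩, ⟨_, s', t', hs', ht', hst', e2⟩⟩)
    · exact ⟨hx, 1, CS.B_refl _⟩
    · refine ⟨hy, ?_⟩
      have e1 : s • T.hat a + t • T.hat b = T.hat x := e1
      have e2 : s' • T.hat a + t' • T.hat b = T.hat y := e2
      rw [← e1, ← e2]
      exact CS.B_of_seg (hat_K ha) (hat_K hb) hs ht hs' ht'
  · rintro ⟨hy, r, α0, β0, a0, b0, k0, l0, -⟩
    obtain ⟨α, hα, k⟩ : ∃ α : ℝ, 1 < α ∧ α • T.hat y - T.hat x ∈ T.toCS.K := by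
      refine ⟨α0 + 2, by linarith, ?_⟩
      have := T.toCS.K_add k0 (T.toCS.K_smul (t := 2) (by norm_num) (hat_K hy))
      convert this using 1; module
    obtain ⟨β, hβ, l⟩ : ∃ β : ℝ, 1 < β ∧ β • T.hat x - T.hat y ∈ T.toCS.K := by
      refine ⟨β0 + 2, by linarith, ?_⟩
      have := T.toCS.K_add l0 (T.toCS.K_smul (t := 2) (by norm_num) (hat_K hx))
      convert this using 1; module
    have pα : 0 < α - 1 := by linarith
    have pβ : 0 < β - 1 := by linarith
    have pp : 0 < α * β - 1 := by nlinarith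
    obtain ⟨a, ha, ea⟩ := exists_of_K (T.toCS.K_smul (inv_pos.2 pβ).le l) (by
      rw [map_smul, map_sub, map_smul, f_hat hx, f_hat hy, smul_eq_mul, smul_eq_mul, mul_one,
        inv_mul_cancel₀ pβ.ne'])
    obtain ⟨b, hb, eb⟩ := exists_of_K (T.toCS.K_smul (inv_pos.2 pα).le k) (by
      rw [map_smul, map_sub, map_smul, f_hat hx, f_hat hy, smul_eq_mul, smul_eq_mul, mul_one,
        inv_mul_cancel₀ pα.ne'])
    have ea' : (β - 1) • T.hat a = β • T.hat x - T.hat y := by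
      rw [ea, smul_smul, mul_inv_cancel₀ pβ.ne', one_smul]
    have eb' : (α - 1) • T.hat b = α • T.hat y - T.hat x := by
      rw [eb, smul_smul, mul_inv_cancel₀ pα.ne', one_smul]
    refine Or.inr ⟨hy, a, ha, b, hb, ⟨hx, ?_⟩, ⟨hy, ?_⟩⟩
    · refine ⟨α * (β - 1) / (α * β - 1), (α - 1) / (α * β - 1), by positivity, by positivity, ?_, ?_⟩
      · rw [← add_div, div_eq_one_iff_eq pp.ne']; ring
      · show (α * (β - 1) / (α * β - 1)) • T.hat a + ((α - 1) / (α * β - 1)) • T.hat b = T.hat x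
        have : (α * β - 1)⁻¹ • (α • ((β - 1) • T.hat a) + (α - 1) • T.hat b) = T.hat x := by
          rw [ea', eb']
          have : α • (β • T.hat x - T.hat y) + (α • T.hat y - T.hat x) = (α * β - 1) • T.hat x := by
            module
          rw [this, smul_smul, inv_mul_cancel₀ pp.ne', one_smul]
        rw [← this, div_eq_inv_mul, div_eq_inv_mul]; module
    · refine ⟨(β - 1) / (α * β - 1), β * (α - 1) / (α * β - 1), by positivity, by positivity, ?_, ?_⟩
      · rw [← add_div, div_eq_one_iff_eq pp.ne']; ring
      · show ((β - 1) / (α * β - 1)) • T.hat a + (β * (α - 1) / (α * β - 1)) • T.hat b = T.hat y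
        have : (α * β - 1)⁻¹ • ((β - 1) • T.hat a + β • ((α - 1) • T.hat b)) = T.hat y := by
          rw [ea', eb']
          have : (β • T.hat x - T.hat y) + β • (α • T.hat y - T.hat x) = (α * β - 1) • T.hat y := by
            module
          rw [this, smul_smul, inv_mul_cancel₀ pp.ne', one_smul]
        rw [← this, div_eq_inv_mul, div_eq_inv_mul]; module

lemma face_sub {x : PSpace d} (hx : x ∈ closure T.Ω) : face T.Ω x ⊆ closure T.Ω :=
  fun _ hy => ((face_iff hx).1 hy).1

lemma hat_mk {v : Fin d → ℝ} (h : v ≠ 0) : T.hat (Projectivization.mk ℝ v h) = (T.fT v)⁻¹ • v :=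
  cm_mk _ h

lemma Lf_iff {x : PSpace d} (hx : x ∈ closure T.Ω) {v : Fin d → ℝ} :
    v ∈ T.toCS.Lf (T.hat x) ↔ 0 < T.fT v ∧ v ∈ cone (face T.Ω x) := by
  constructor
  · intro hv
    have h0 := CS.Lf_ne (hat_K hx) (hat_ne hx) hv
    have hK := CS.Lf_K (hat_K hx) hv
    have hf : 0 < T.fT v := T.toCS.f_posK hK h0
    refine ⟨hf, ?_⟩
    rw [cone_mk h0, face_iff hx, hat_mk]
    obtain ⟨r, hr⟩ := hv
    refine ⟨((K_iff hf).1 hK).2, r, hr.smul_right (inv_pos.2 hf)⟩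
  · rintro ⟨hf, h0, hv⟩
    rw [face_iff hx, hat_mk] at hv
    obtain ⟨_, r, hr⟩ := hv
    exact ⟨r, (CS.B_smul_right_iff (inv_pos.2 hf)).1 hr⟩

lemma face_pc {x : PSpace d} (hx : x ∈ closure T.Ω) : IsProperlyConvex (face T.Ω x) := by
  have hcl : closure (face T.Ω x) ⊆ closure T.Ω := closure_minimal (face_sub hx) isClosed_closure
  have him : ∀ w, w ∈ chartMap T.fT '' face T.Ω x ↔ T.fT w = 1 ∧ w ∈ T.toCS.Lf (T.hat x) := by
    intro w
    rw [im_iff (fun y hy => T.spec.1 y (face_sub hx hy)), Lf_iff hx]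
    constructor
    · rintro ⟨h1, h2⟩
      exact ⟨h1, by rw [h1]; norm_num, h2⟩
    · rintro ⟨h1, -, h2⟩
      exact ⟨h1, h2⟩
  refine ⟨T.fT, fun y hy => T.spec.1 y (hcl hy), ?_, ?_⟩
  · intro u hu v hv a b ha hb hab
    rw [him] at hu hv ⊢
    refine ⟨by simp [hu.1, hv.1, hab], ?_⟩
    rcases ha.eq_or_lt with h | h
    · have : b = 1 := by linarith
      rw [← h, this, zero_smul, zero_add, one_smul]; exact hv.2
    · rcases hb.eq_or_lt with h' | h'
      · have : a = 1 := by linarith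
        rw [← h', this, zero_smul, add_zero, one_smul]; exact hu.2
      · exact CS.Lf_add (hat_K hx) (CS.Lf_smul h hu.2) (CS.Lf_smul h' hv.2)
  · rw [isBounded_iff_forall_norm_le]
    refine ⟨T.toCS.N, fun w hw => ?_⟩
    obtain ⟨h1, h2⟩ := (him w).1 hw
    have h3 := T.toCS.bddK (CS.Lf_K (hat_K hx) h2)
    have h4 : T.toCS.f w = 1 := h1
    rwa [h4, mul_one] at h3

lemma hilb {x : PSpace d} (hx : x ∈ closure T.Ω) {y z : PSpace d} (hy : y ∈ face T.Ω x)
    (hz : z ∈ face T.Ω x) (ρ : ℝ) :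
    hilbertDist (face T.Ω x) y z ≤ ρ ↔ T.toCS.B (Real.exp (2 * ρ)) (T.hat y) (T.hat z) := by
  obtain ⟨s1, s2, s3⟩ := chartOf_spec (face_pc hx)
  set F := face T.Ω x with hF
  set f' := chartOf F with hf'
  have hrep : ∀ y ∈ F, f' y.rep ≠ 0 := fun y hy => s1 y (subset_closure hy)
  obtain ⟨σ, hσ, hpos⟩ := sign_const (L := T.toCS.Lf (T.hat x))
    (fun u hu v hv => CS.Lf_add (hat_K hx) hu hv) (fun t ht v hv => CS.Lf_smul ht hv) f' (by
      intro v hv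
      obtain ⟨_, h0, h1⟩ := (Lf_iff hx).1 hv
      exact (frep_ne _ h0).1 (hrep _ h1))
  have hσ0 : σ ≠ 0 := by rcases hσ with h | h <;> rw [h] <;> norm_num
  have hσ2 : σ * σ = 1 := by rcases hσ with h | h <;> rw [h] <;> norm_num
  have hO : ∀ w, w ∈ chartMap f' '' F ↔ f' w = 1 ∧ σ • w ∈ T.toCS.Lf (T.hat x) := by
    intro w
    rw [im_iff hrep]
    refine and_congr_right fun h1 => ?_
    rw [Lf_iff hx, cone_smul hσ0]
    refine ⟨fun h2 => ⟨?_, h2⟩, fun h => h.2⟩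
    by_contra hn
    have hne : T.fT (σ • w) ≠ 0 := by
      have h3 := (cone_smul hσ0).2 h2
      obtain ⟨h0, h3⟩ := h3
      exact (frep_ne _ h0).1 (T.spec.1 _ (face_sub hx h3))
    have hlt : T.fT (σ • w) < 0 := lt_of_le_of_ne (not_lt.1 hn) hne
    have hm : (-σ) • w ∈ T.toCS.Lf (T.hat x) := by
      rw [Lf_iff hx]
      refine ⟨?_, (cone_smul (neg_ne_zero.2 hσ0)).2 h2⟩
      rw [neg_smul, map_neg]; linarith
    have := hpos _ hm
    rw [map_smul, h1, smul_eq_mul, mul_one] at this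
    linarith [hσ2]
  have sc : ∀ y ∈ F, ∃ c : ℝ, 0 < c ∧ c • (σ • chartMap f' y) = T.hat y := by
    intro y hy
    have hm : σ • chartMap f' y ∈ T.toCS.Lf (T.hat x) := ((hO _).1 ⟨y, hy, rfl⟩).2
    have hp := ((Lf_iff hx).1 hm).1
    refine ⟨_, inv_pos.2 hp, ?_⟩
    have h0 : σ • chartMap f' y ≠ 0 := smul_ne_zero hσ0 (cm_ne (hrep y hy))
    rw [← cm_mk T.fT h0, hat]
    congr 1
    conv_rhs => rw [← mk_cm (hrep y hy)]
    rw [Projectivization.mk_eq_mk_iff']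
    exact ⟨σ, rfl⟩
  obtain ⟨c, hc, ec⟩ := sc y hy
  obtain ⟨c', hc', ec'⟩ := sc z hz
  rw [← ec, ← ec', CS.B_smul_left_iff hc, CS.B_smul_right_iff hc']
  exact CS.hil (hat_K hx) (hat_ne hx) s3 f' σ hσ0 hO ⟨y, hy, rfl⟩ ⟨z, hz, rfl⟩ ρ

lemma hat_P {x : PSpace d} (hx : x ∈ closure T.Ω) : T.hat x ∈ T.toCS.P ↔ x ∈ T.Ω := by
  constructor
  · intro h
    exact (cm_cone (T.spec.1 x hx)).1 h.1
  · intro h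
    exact T.cm_pc (T.spec.1 x hx) h

lemma face_Ω {x : PSpace d} (hx : x ∈ T.Ω) : face T.Ω x = T.Ω := by
  have hx' := subset_closure hx
  ext y
  rw [face_iff hx']
  constructor
  · rintro ⟨hy, r, hr⟩
    exact (hat_P hy).1 (hr.mem_P ((hat_P hx').2 hx))
  · intro hy
    exact ⟨subset_closure hy, T.toCS.B_of_P ((hat_P hx').2 hx) ((hat_P (subset_closure hy)).2 hy)⟩

lemma hilbΩ {y z : PSpace d} (hy : y ∈ T.Ω) (hz : z ∈ T.Ω) (ρ : ℝ) :
    hilbertDist T.Ω y z ≤ ρ ↔ T.toCS.B (Real.exp (2 * ρ)) (T.hat y) (T.hat z) := by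
  have h := face_Ω hy
  have := hilb (subset_closure hy) (y := y) (z := z) (by rw [h]; exact hy) (by rw [h]; exact hz) ρ
  rwa [h] at this

variable (T) in
def dd (u v : Fin d → ℝ) : ℝ := hilbertDistChart (cmap T.Ω '' T.Ω) (T.toCS.nz u) (T.toCS.nz v)

lemma dd_hat {x y : PSpace d} (hx : x ∈ closure T.Ω) (hy : y ∈ closure T.Ω) :
    T.dd (T.hat x) (T.hat y) = hilbertDist T.Ω x y := by
  have h1 : T.toCS.f (T.hat x) = 1 := f_hat hx
  have h2 : T.toCS.f (T.hat y) = 1 := f_hat hy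
  rw [dd, CS.nz, CS.nz, h1, h2, inv_one, one_smul, one_smul]
  rfl

lemma dd_mk {u v : Fin d → ℝ} (hu : u ≠ 0) (hv : v ≠ 0) :
    T.dd u v = hilbertDist T.Ω (Projectivization.mk ℝ u hu) (Projectivization.mk ℝ v hv) := by
  rw [hilbertDist, dd]
  congr 1
  · exact (hat_mk hu).symm
  · exact (hat_mk hv).symm

lemma isDD : T.toCS.IsDD T.dd := by
  rintro u ⟨⟨hu, hu'⟩, fu⟩ v ⟨⟨hv, hv'⟩, fv⟩ ρ
  rw [dd_mk hu hv, hilbΩ hu' hv', hat_mk, hat_mk, CS.B_smul_left_iff (inv_pos.2 fu),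
    CS.B_smul_right_iff (inv_pos.2 fv)]

lemma H4_iff : T.toCS.H4 T.dd ↔ GromovHyperbolicOn T.Ω T.C := by
  constructor
  · rintro ⟨δ, hδ, h⟩
    refine ⟨δ, hδ, fun x hx y hy z hz w hw => ?_⟩
    have hc : ∀ {x}, x ∈ T.C → x ∈ closure T.Ω := fun h => subset_closure (T.C_sub h)
    have hD : ∀ {x}, x ∈ T.C → T.hat x ∈ T.toCS.D := fun h => T.cm_pc (T.spec.1 _ (hc h)) h
    have := h _ (hD hx) _ (hD hy) _ (hD hz) _ (hD hw)
    simp only [CS.gp, dd_hat (hc hx) (hc hw), dd_hat (hc hx) (hc hy), dd_hat (hc hy) (hc hw),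
      dd_hat (hc hy) (hc hz), dd_hat (hc hz) (hc hw), dd_hat (hc hx) (hc hz)] at this
    exact this
  · rintro ⟨δ, hδ, h⟩
    refine ⟨δ, hδ, ?_⟩
    rintro x ⟨⟨hx0, hx⟩, -⟩ y ⟨⟨hy0, hy⟩, -⟩ z ⟨⟨hz0, hz⟩, -⟩ w ⟨⟨hw0, hw⟩, -⟩
    have := h _ hx _ hy _ hz _ hw
    simp only [CS.gp, dd_mk hx0 hw0, dd_mk hx0 hy0, dd_mk hy0 hw0, dd_mk hy0 hz0, dd_mk hz0 hw0,
      dd_mk hx0 hz0]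
    exact this

lemma ib_cl {x : PSpace d} (hx : x ∈ idealBdry T.C) : x ∈ closure T.Ω := closure_mono T.C_sub hx.1

lemma ib_E {x : PSpace d} (hx : x ∈ idealBdry T.C) : T.hat x ∈ T.toCS.E := by
  have hc := ib_cl hx
  refine ⟨?_, hat_ne hc, fun h => ?_⟩
  · have : T.hat x ∈ closure (pc T.fT T.C) := by
      rw [pc_closure (by rw [f_hat hc]; norm_num)]
      exact (cm_cone (T.spec.1 x hc)).2 hx.1
    exact this
  · exact hx.2 (T.C_closedInΩ ⟨hx.1, (hat_P hc).1 h⟩)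

lemma E_ib {v : Fin d → ℝ} (hv : v ∈ T.toCS.E) : Projectivization.mk ℝ v hv.2.1 ∈ idealBdry T.C := by
  have hf : 0 < T.fT v := T.toCS.E_pos hv
  have h1 : v ∈ closure (pc T.fT T.C) := hv.1
  rw [pc_closure hf, cone_mk hv.2.1] at h1
  exact ⟨h1, fun h => hv.2.2 (T.toCS.D_sub ⟨⟨hv.2.1, h⟩, hf⟩)⟩

lemma B_mk {y z : Fin d → ℝ} (hy : y ∈ T.toCS.E) (hz : z ∈ T.toCS.E) {r : ℝ} :
    T.toCS.B r (T.hat (Projectivization.mk ℝ y hy.2.1)) (T.hat (Projectivization.mk ℝ z hz.2.1)) ↔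
      T.toCS.B r y z := by
  have fy : 0 < T.fT y := T.toCS.E_pos hy
  have fz : 0 < T.fT z := T.toCS.E_pos hz
  rw [hat_mk, hat_mk, CS.B_smul_left_iff (inv_pos.2 fy), CS.B_smul_right_iff (inv_pos.2 fz)]

lemma le_exp (r : ℝ) : r ≤ Real.exp (2 * max r 1) := by
  have := Real.add_one_le_exp (2 * max r 1)
  linarith [le_max_left r 1, le_max_right r 1]

lemma one_iff : (∃ R : ℝ, 0 < R ∧ ∀ x ∈ idealBdry T.C, ∀ y ∈ idealBdry T.C ∩ face T.Ω x,
        ∀ z ∈ idealBdry T.C ∩ face T.Ω x, hilbertDist (face T.Ω x) y z ≤ R) ↔ T.toCS.H1 := by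
  constructor
  · rintro ⟨R, -, hR⟩
    refine ⟨Real.exp (2 * R), fun y hy z hz hB => ?_⟩
    have hy' := E_ib hy
    have hz' := E_ib hz
    have hf := (face_iff (ib_cl hy') (y := Projectivization.mk ℝ z hz.2.1)).2
      ⟨ib_cl hz', by obtain ⟨r, hr⟩ := hB; exact ⟨r, (B_mk hy hz).2 hr⟩⟩
    have := hR _ hy' _ ⟨hy', Or.inl rfl⟩ _ ⟨hz', hf⟩
    rw [hilb (ib_cl hy') (Or.inl rfl) hf, B_mk hy hz] at this
    exact this
  · rintro ⟨r, hr⟩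
    refine ⟨max r 1, by positivity, fun x hx y hy z hz => ?_⟩
    rw [hilb (ib_cl hx) hy.2 hz.2]
    obtain ⟨_, r1, h1⟩ := (face_iff (ib_cl hx)).1 hy.2
    obtain ⟨_, r2, h2⟩ := (face_iff (ib_cl hx)).1 hz.2
    exact (hr _ (ib_E hy.1) _ (ib_E hz.1) ⟨_, h1.symm.trans h2⟩).mono (le_exp r)

lemma two_iff : (∀ x ∈ idealBdry T.C, cdim (face T.Ω x) (idealBdry T.C ∩ face T.Ω x) = 0) ↔
    T.toCS.H2 := by
  constructor
  · intro h y hy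
    have hy' := E_ib hy
    have hcl := ib_cl hy'
    have hx := h _ hy'
    set x := Projectivization.mk ℝ y hy.2.1 with hxdef
    rw [cdim, Nat.sInf_eq_zero] at hx
    obtain ⟨R, hR, B, hBF, hconv, hdim, hA⟩ | hx := hx
    · obtain ⟨hxF, q, hq, hxq⟩ := hA ⟨hy', Or.inl rfl⟩
      have hsub : ∀ q' ∈ B, q' = q := by
        intro q' hq'
        rw [pdimIn, Submodule.finrank_eq_zero] at hdim
        have hd := AffineSubspace.vsub_mem_direction
          (subset_affineSpan ℝ _ (mem_image_of_mem (cmap (face T.Ω x)) hq'))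
          (subset_affineSpan ℝ _ (mem_image_of_mem (cmap (face T.Ω x)) hq))
        rw [hdim, Submodule.mem_bot, vsub_eq_zero_iff_eq] at hd
        have s1 := (chartOf_spec (face_pc hcl)).1
        have h1 := mk_cm (s1 q' (subset_closure (hBF hq')))
        have h2 := mk_cm (s1 q (subset_closure (hBF hq)))
        rw [← h1, ← h2]
        congr 1
      refine ⟨Real.exp (2 * R) * Real.exp (2 * R), fun z hz hB => ?_⟩
      have hz' := E_ib hz
      have hf := (face_iff hcl (y := Projectivization.mk ℝ z hz.2.1)).2
        ⟨ib_cl hz', by obtain ⟨r, hr⟩ := hB; exact ⟨r, (B_mk hy hz).2 hr⟩⟩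
      obtain ⟨hzF, q', hq', hzq⟩ := hA ⟨hz', hf⟩
      rw [hsub q' hq'] at hzq
      have b1 := (hilb hcl hxF (hBF hq) R).1 hxq.le
      have b2 := (hilb hcl hzF (hBF hq) R).1 hzq.le
      exact (B_mk hy hz).1 (b1.trans b2.symm)
    · exfalso
      have : pdimIn (face T.Ω x) (face T.Ω x) ∈ (∅ : Set ℕ) := by
        rw [← hx]
        refine ⟨1, one_pos, face T.Ω x, Subset.rfl, (chartOf_spec (face_pc hcl)).2.1, rfl, ?_⟩
        rintro p ⟨-, hp⟩
        exact ⟨hp, p, hp, by simp [hilbertDist, hilbertDistChart]⟩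
      exact this
  · intro h x hx
    rw [cdim, Nat.sInf_eq_zero]
    left
    have hcl := ib_cl hx
    obtain ⟨r, hr⟩ := h _ (ib_E hx)
    refine ⟨max r 1 + 1, by positivity, {x}, ?_, ?_, ?_, ?_⟩
    · rw [singleton_subset_iff]; exact Or.inl rfl
    · rw [image_singleton]; exact convex_singleton _
    · simp [pdimIn, direction_affineSpan]
    · rintro z ⟨hz, hzF⟩
      refine ⟨hzF, x, rfl, ?_⟩
      have h1 := ((face_iff hcl).1 hzF).2
      have := (hilb hcl hzF (Or.inl rfl) (max r 1)).2
        ((hr _ (ib_E hz) h1).symm.mono (le_exp r))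
      linarith

end NCCTriple
end

section
variable {d : ℕ}

lemma simplex_smul {p : ℕ} : ∀ t : ℝ, 0 < t → ∀ v ∈ simplexCone (d := d) p,
    t • v ∈ simplexCone (d := d) p := by
  intro t ht v hv
  refine ⟨fun i hi => ?_, fun i hi => ?_⟩
  · exact mul_pos ht (hv.1 i hi)
  · simp [hv.2 i hi]

lemma simplex_add {p : ℕ} : ∀ u ∈ simplexCone (d := d) p, ∀ v ∈ simplexCone (d := d) p,
    u + v ∈ simplexCone (d := d) p := by
  intro u hu v hv
  refine ⟨fun i hi => ?_, fun i hi => ?_⟩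
  · exact add_pos (hu.1 i hi) (hv.1 i hi)
  · simp [hv.2 i hi, hu.2 i hi]

lemma simplex_ne {p : ℕ} (hp : p + 1 ≤ d) {v : Fin d → ℝ} (hv : v ∈ simplexCone (d := d) (p + 1)) :
    v ≠ 0 := by
  rintro rfl
  have := hv.1 ⟨0, by omega⟩ (by simp)
  simp at this

lemma simplex_closure {p : ℕ} {v : Fin d → ℝ} (hv : v ∈ closure (simplexCone (d := d) p)) :
    (∀ i, 0 ≤ v i) ∧ ∀ i : Fin d, p ≤ (i : ℕ) → v i = 0 := by
  have h1 : IsClosed {v : Fin d → ℝ | ∀ i, 0 ≤ v i} := by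
    simp only [setOf_forall]
    exact isClosed_iInter fun i => isClosed_le continuous_const (continuous_apply i)
  have h2 : IsClosed {v : Fin d → ℝ | ∀ i : Fin d, p ≤ (i : ℕ) → v i = 0} := by
    simp only [setOf_forall]
    exact isClosed_iInter fun i => isClosed_iInter fun _ =>
      isClosed_eq (continuous_apply i) continuous_const
  have hsub : simplexCone (d := d) p ⊆ {v : Fin d → ℝ | ∀ i, 0 ≤ v i} ∩
      {v : Fin d → ℝ | ∀ i : Fin d, p ≤ (i : ℕ) → v i = 0} := by
    intro v hv
    refine ⟨fun i => ?_, hv.2⟩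
    by_cases h : (i : ℕ) < p
    · exact (hv.1 i h).le
    · rw [hv.2 i (by omega)]
  exact closure_minimal hsub (h1.inter h2) hv

namespace NCCTriple
variable {T : NCCTriple d}

lemma no_simplex' (h2 : T.toCS.H2) {S : Set (PSpace d)} {k : ℕ} (hk : 2 ≤ k)
    (hS : IsSimplexOfDim k S) (hSC : S ⊆ T.C) (hpe : IsProperlyEmbedded S T.C) : False := by
  obtain ⟨hkd, g, hg⟩ := hS
  have hclS : ∀ q ∈ closure S, q ∈ T.C → q ∈ S := by
    obtain ⟨hsub, hprop⟩ := hpe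
    have hr := hprop.isClosedMap.isClosed_range
    rw [isClosed_induced_iff] at hr
    obtain ⟨Z, hZ, he⟩ := hr
    intro q hq hqC
    have hSZ : S ⊆ Z := by
      intro s hs
      have : inclusion hsub ⟨s, hs⟩ ∈ Subtype.val ⁻¹' Z := by rw [he]; exact ⟨_, rfl⟩
      exact this
    have hqZ := closure_minimal hSZ hZ hq
    have : (⟨q, hqC⟩ : T.C) ∈ range (inclusion hsub) := by rw [← he]; exact hqZ
    obtain ⟨⟨s, hs⟩, hs'⟩ := this
    have : s = q := congrArg Subtype.val hs'
    rwa [← this]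
  have hgS : ∀ v ∈ simplexCone (d := d) (k + 1), g v ∈ cone S := by
    intro v hv
    have h0 := simplex_ne hkd hv
    refine ⟨by simpa using h0, ?_⟩
    rw [hg]
    exact ⟨v, hv, h0, rfl⟩
  have hSΩ : ∀ {u}, u ∈ cone S → u ∈ cone T.Ω := fun ⟨h, h'⟩ => ⟨h, T.C_sub (hSC h')⟩
  obtain ⟨σ, hσ, hpos⟩ := sign_const simplex_add simplex_smul (T.fT ∘ₗ g.toLinearMap)
    (fun v hv => T.cone_ne (hSΩ (hgS v hv)))
  have hσ0 : σ ≠ 0 := by rcases hσ with h | h <;> rw [h] <;> norm_num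
  obtain ⟨g', hg'⟩ : ∃ g' : (Fin d → ℝ) ≃ₗ[ℝ] (Fin d → ℝ), ∀ v, g' v = σ • g v := by
    rcases hσ with h | h
    · exact ⟨g, fun v => by rw [h, one_smul]⟩
    · exact ⟨g.trans (LinearEquiv.neg ℝ), fun v => by rw [h]; simp⟩
  have hg'S : ∀ v ∈ simplexCone (d := d) (k + 1), g' v ∈ cone S := by
    intro v hv
    rw [hg', cone_smul hσ0]; exact hgS v hv
  have hD : ∀ v ∈ simplexCone (d := d) (k + 1), g' v ∈ T.toCS.D := by
    intro v hv
    obtain ⟨h0, h1⟩ := hg'S v hv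
    refine ⟨⟨h0, hSC h1⟩, ?_⟩
    rw [hg', map_smul, smul_eq_mul]
    exact hpos v hv
  refine CS.no_simplex h2 g' hk hkd hD fun v hv hP => ?_
  have gcont : Continuous g' := LinearMap.continuous_of_finiteDimensional g'.toLinearMap
  have hDv : g' v ∈ T.toCS.D := T.toCS.D_closed ⟨map_mem_closure gcont hv hD, hP⟩
  obtain ⟨⟨h0, hC⟩, hf⟩ := hDv
  have hc : g' v ∈ cone (closure S) := by
    rw [← closure_cone h0]
    exact map_mem_closure gcont hv hg'S
  have hmS := hclS _ hc.2 hC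
  rw [hg] at hmS
  obtain ⟨w, hw, hw0, e⟩ := hmS
  rw [Projectivization.mk_eq_mk_iff'] at e
  obtain ⟨a, ha⟩ := e
  have hvw : v = (σ⁻¹ * a) • w := by
    apply g.injective
    rw [map_smul, mul_smul, ha, hg', smul_smul, inv_mul_cancel₀ hσ0, one_smul]
  set c := σ⁻¹ * a
  have hi0 : (0 : ℕ) < d := by omega
  have hnn := (simplex_closure hv).1 ⟨0, hi0⟩
  have hwp := hw.1 ⟨0, hi0⟩ (by simp)
  have hc0 : c ≠ 0 := by
    intro hc0
    rw [hc0, zero_smul] at hvw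
    apply h0
    rw [hvw, map_zero]
  have hcp : 0 < c := by
    rw [hvw] at hnn
    have hnn : 0 ≤ c * w ⟨0, hi0⟩ := hnn
    exact lt_of_le_of_ne (nonneg_of_mul_nonneg_left hnn hwp) hc0.symm
  rw [hvw]
  exact simplex_smul c hcp w hw

lemma simplex_of_not (h2 : ¬ T.toCS.H2) : ∃ S : Set (PSpace d), ∃ k : ℕ, 2 ≤ k ∧
    IsSimplexOfDim k S ∧ S ⊆ T.C ∧ IsProperlyEmbedded S T.C := by
  obtain ⟨v, hli, hcl, hin, hout⟩ := CS.Tri_nice (T.toCS.Tri_of_not_H2 h2)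
  obtain ⟨hd, g, hgv⟩ := exists_equiv v hli
  have hexp : ∀ w : Fin d → ℝ, (∀ i : Fin d, 3 ≤ (i : ℕ) → w i = 0) →
      g w = ∑ j : Fin 3, w (Fin.castLE hd j) • v j := by
    intro w hw
    have : w = ∑ j : Fin 3, w (Fin.castLE hd j) • (Pi.single (Fin.castLE hd j) 1 : Fin d → ℝ) := by
      ext i
      rw [Finset.sum_apply]
      by_cases hi : (i : ℕ) < 3
      · rw [Finset.sum_eq_single ⟨i, hi⟩]
        · have : Fin.castLE hd ⟨i, hi⟩ = i := by ext; simp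
          rw [this]; simp
        · intro j _ hj
          have : i ≠ Fin.castLE hd j := by
            rintro rfl
            apply hj; ext; simp
          simp [this]
        · simp
      · rw [hw i (by omega), Finset.sum_eq_zero]
        intro j _
        have : i ≠ Fin.castLE hd j := by
          rintro rfl
          exact hi (by simp)
        simp [this]
    conv_lhs => rw [this]
    rw [map_sum]
    simp only [map_smul, hgv]
  have hD : ∀ w ∈ simplexCone (d := d) 3, g w ∈ T.toCS.D := by
    intro w hw
    rw [hexp w hw.2]
    exact hin _ fun j => hw.1 _ (by simp)
  set S : Set (PSpace d) := {q : PSpace d | ∃ v ∈ simplexCone (d := d) (2 + 1), ∃ hv : v ≠ 0,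
        q = Projectivization.mk ℝ (g v) (by simpa using hv)} with hS
  have hSC : S ⊆ T.C := by
    rintro q ⟨w, hw, hw0, rfl⟩
    exact (hD w hw).1.2
  have hpcS : pc T.fT S ⊆ g '' simplexCone (d := d) 3 := by
    rintro u ⟨⟨hu0, w, hw, hw0, e⟩, hf⟩
    rw [Projectivization.mk_eq_mk_iff'] at e
    obtain ⟨a, ha⟩ := e
    have hfw : 0 < T.fT (g w) := (hD w hw).2
    rw [← ha, map_smul, smul_eq_mul] at hf
    have hap : 0 < a := (pos_iff_pos_of_mul_pos hf).2 hfw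
    exact ⟨a • w, simplex_smul a hap w hw, by rw [map_smul, ha]⟩
  have hclS : ∀ q ∈ closure S, q ∈ T.C → q ∈ S := by
    intro q hq hqC
    have hqΩ := T.C_sub hqC
    have hqcl : q ∈ closure T.Ω := subset_closure hqΩ
    have hP : T.hat q ∈ T.toCS.P := (hat_P hqcl).2 hqΩ
    have h1 : T.hat q ∈ closure (pc T.fT S) := by
      rw [pc_closure (by rw [f_hat hqcl]; norm_num)]
      exact (cm_cone (T.spec.1 q hqcl)).2 hq
    have h2 := closure_mono hpcS h1
    have gcont : Continuous g.symm := LinearMap.continuous_of_finiteDimensional g.symm.toLinearMap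
    have h3 : g.symm (T.hat q) ∈ closure (simplexCone (d := d) 3) := by
      refine map_mem_closure gcont h2 ?_
      rintro _ ⟨w, hw, rfl⟩
      rw [g.symm_apply_apply]; exact hw
    obtain ⟨n1, n2⟩ := simplex_closure h3
    have e := hexp _ n2
    rw [g.apply_symm_apply] at e
    have hw : g.symm (T.hat q) ∈ simplexCone (d := d) (2 + 1) := by
      refine ⟨fun i hi => ?_, n2⟩
      refine lt_of_le_of_ne (n1 i) fun hz => ?_
      refine hout (fun j => g.symm (T.hat q) (Fin.castLE hd j)) (fun j => n1 _) ⟨⟨i, hi⟩, ?_⟩ ?_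
      · have : Fin.castLE hd ⟨i, hi⟩ = i := by ext; simp
        rw [this]; exact hz.symm
      · rw [← e]; exact hP
    refine ⟨_, hw, simplex_ne hd hw, ?_⟩
    have h5 := mk_cm (T.spec.1 q hqcl)
    conv_lhs => rw [← h5]
    congr 1
    rw [g.apply_symm_apply]; rfl
  refine ⟨S, 2, le_rfl, ⟨hd, g, rfl⟩, hSC, hSC, ?_⟩
  apply Topology.IsClosedEmbedding.isProperMap
  refine ⟨Topology.IsEmbedding.inclusion hSC, ?_⟩
  rw [isClosed_induced_iff]
  refine ⟨closure S, isClosed_closure, ?_⟩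
  ext ⟨q, hq⟩
  constructor
  · intro h
    exact ⟨⟨q, hclS q h hq⟩, rfl⟩
  · rintro ⟨⟨s, hs⟩, e⟩
    have : s = q := congrArg Subtype.val e
    subst this
    exact subset_closure hs

lemma three_iff : (¬ ∃ S : Set (PSpace d), ∃ k : ℕ, 2 ≤ k ∧ IsSimplexOfDim k S ∧ S ⊆ T.C ∧
        IsProperlyEmbedded S T.C) ↔ T.toCS.H2 := by
  constructor
  · intro h
    by_contra h2
    exact h (simplex_of_not h2)
  · rintro h2 ⟨S, k, hk, hS, hSC, hpe⟩
    exact no_simplex' h2 hk hS hSC hpe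

lemma H14 : T.toCS.H1 ↔ GromovHyperbolicOn T.Ω T.C := by
  rw [← H4_iff]
  exact ⟨fun h => CS.H2_H4 isDD (T.toCS.H1_H2 h), fun h => CS.H4_H1 isDD h⟩

lemma H24 : T.toCS.H2 ↔ GromovHyperbolicOn T.Ω T.C := by
  rw [← H4_iff]
  exact ⟨fun h => CS.H2_H4 isDD h, fun h => T.toCS.H1_H2 (CS.H4_H1 isDD h)⟩

end NCCTriple
end

/-- Theorem 5.1, items (1)-(4): for a naive convex co-compact triple the
following are equivalent: uniformly bounded face diameters; all faces of coarse dimension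
zero; no properly embedded simplex of dimension at least two; Gromov hyperbolicity of
`(C, d_Ω)`. -/
theorem ncc_gromov_hyperbolic_characterization {d : ℕ} (T : NCCTriple d) :
    ((∃ R : ℝ, 0 < R ∧ ∀ x ∈ idealBdry T.C, ∀ y ∈ idealBdry T.C ∩ face T.Ω x,
        ∀ z ∈ idealBdry T.C ∩ face T.Ω x, hilbertDist (face T.Ω x) y z ≤ R) ↔
      GromovHyperbolicOn T.Ω T.C) ∧
    ((∀ x ∈ idealBdry T.C, cdim (face T.Ω x) (idealBdry T.C ∩ face T.Ω x) = 0) ↔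
      GromovHyperbolicOn T.Ω T.C) ∧
    ((¬ ∃ S : Set (PSpace d), ∃ k : ℕ, 2 ≤ k ∧ IsSimplexOfDim k S ∧ S ⊆ T.C ∧
        IsProperlyEmbedded S T.C) ↔
      GromovHyperbolicOn T.Ω T.C) := by
  refine ⟨?_, ?_, ?_⟩
  · rw [NCCTriple.one_iff, NCCTriple.H14]
  · rw [NCCTriple.two_iff, NCCTriple.H24]
  · rw [NCCTriple.three_iff, NCCTriple.H24]

end Paper
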